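/- Let f be a PSCF that satisfies population-consistency and composition-consistency and let A' ⊆ A be agendas. Then there exists a set X of profiles on A, each regular on A', such that X has affine dimension |A|! − |A'| and the uniform lottery uni(A') belongs to f(R) for every R ∈ X. -/

import Mathlib

open Finset

namespace PSC

/-- `r` is a linear order (complete, transitive, antisymmetric; as a set of pairs) on `A`. -/
def IsLinearOrderOn (A : Finset ℕ) (r : Finset (ℕ × ℕ)) : Prop :=
  r ⊆ A ×ˢ A ∧ (∀ x ∈ A, (x, x) ∈ r) ∧
    (∀ x ∈ A, ∀ y ∈ A, (x, y) ∈ r ∨ (y, x) ∈ r) ∧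
    (∀ x y z : ℕ, (x, y) ∈ r → (y, z) ∈ r → (x, z) ∈ r) ∧
    (∀ x y : ℕ, (x, y) ∈ r → (y, x) ∈ r → x = y)

open Classical in
/-- The set `L(A)` of linear orders on the agenda `A`. -/
noncomputable def linOrders (A : Finset ℕ) : Finset (Finset (ℕ × ℕ)) :=
  (A ×ˢ A).powerset.filter (fun r => IsLinearOrderOn A r)

/-- `R` is a (fractional) preference profile on the agenda `A`. -/
def IsProfile (A : Finset ℕ) (R : Finset (ℕ × ℕ) → ℚ) : Prop :=
  (∀ r, r ∉ linOrders A → R r = 0) ∧ (∀ r, 0 ≤ R r) ∧ (∑ r ∈ linOrders A, R r) = 1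

open Classical in
/-- `R(x,y)`: the total weight of orders ranking `x` strictly above `y`. -/
noncomputable def pref (A : Finset ℕ) (R : Finset (ℕ × ℕ) → ℚ) (x y : ℕ) : ℚ :=
  ∑ r ∈ (linOrders A).filter (fun r => (x, y) ∈ r ∧ (y, x) ∉ r), R r

/-- The majority margin `M_R(x,y) = R(x,y) - R(y,x)`. -/
noncomputable def margin (A : Finset ℕ) (R : Finset (ℕ × ℕ) → ℚ) (x y : ℕ) : ℚ :=
  pref A R x y - pref A R y x

/-- `p` is a lottery on `A`. -/
def IsLottery (A : Finset ℕ) (p : ℕ → ℚ) : Prop :=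
  (∀ x, x ∉ A → p x = 0) ∧ (∀ x, 0 ≤ p x) ∧ (∑ x ∈ A, p x) = 1

/-- `Δ(A)`, the set of lotteries on `A`. -/
def lotteries (A : Finset ℕ) : Set (ℕ → ℚ) := {p | IsLottery A p}

/-- 1-norm distance between two profiles on `A`. -/
noncomputable def profileDist (A : Finset ℕ) (R R' : Finset (ℕ × ℕ) → ℚ) : ℚ :=
  ∑ r ∈ linOrders A, |R r - R' r|

/-- 1-norm distance between two lotteries on `A`. -/
noncomputable def lotteryDist (A : Finset ℕ) (p q : ℕ → ℚ) : ℚ :=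
  ∑ x ∈ A, |p x - q x|

/-- Restriction of an order to `B`. -/
def restrictOrder (B : Finset ℕ) (r : Finset (ℕ × ℕ)) : Finset (ℕ × ℕ) := r ∩ B ×ˢ B

open Classical in
/-- The restriction `R|_B` of a profile on `A` to `B`. -/
noncomputable def restrictProfile (A B : Finset ℕ) (R : Finset (ℕ × ℕ) → ℚ) :
    Finset (ℕ × ℕ) → ℚ :=
  fun s => ∑ r ∈ (linOrders A).filter (fun r => restrictOrder B r = s), R r

/-- `B` is a component in the profile `R` on `A`. -/
def IsComponent (A B : Finset ℕ) (R : Finset (ℕ × ℕ) → ℚ) : Prop :=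
  B ⊆ A ∧ ∀ a ∈ A \ B, ∀ b ∈ B, ∀ b' ∈ B, ∀ r ∈ linOrders A, 0 < R r →
    ((a, b) ∈ r ↔ (a, b') ∈ r)

/-- The composed lottery `p ×_b q` (where `B` is the component). -/
def compLottery (B : Finset ℕ) (b : ℕ) (p q : ℕ → ℚ) : ℕ → ℚ :=
  fun x => if x ∈ B then p b * q x else p x

/-- `X ×_b Y` for sets of lotteries. -/
def compSet (B : Finset ℕ) (b : ℕ) (X Y : Set (ℕ → ℚ)) : Set (ℕ → ℚ) :=
  {pr | ∃ p ∈ X, ∃ q ∈ Y, pr = compLottery B b p q}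

/-- A probabilistic social choice function: to every (finite nonempty) agenda `A ⊆ ℕ` and
every profile on `A` it assigns a nonempty convex set of lotteries on `A`; it is upper
hemi-continuous and satisfies unanimity and decisiveness. -/
structure PSCF where
  choice : Finset ℕ → (Finset (ℕ × ℕ) → ℚ) → Set (ℕ → ℚ)
  nonempty : ∀ A : Finset ℕ, A.Nonempty → ∀ R, IsProfile A R → (choice A R).Nonempty
  subset_lotteries : ∀ A : Finset ℕ, A.Nonempty → ∀ R, IsProfile A R →
    choice A R ⊆ lotteries A
  convex : ∀ A : Finset ℕ, A.Nonempty → ∀ R, IsProfile A R →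
    ∀ p ∈ choice A R, ∀ q ∈ choice A R, ∀ t : ℚ, 0 ≤ t → t ≤ 1 →
      (fun x => t * p x + (1 - t) * q x) ∈ choice A R
  continuity : ∀ A : Finset ℕ, A.Nonempty → ∀ R, IsProfile A R → ∀ ε : ℚ, 0 < ε →
    ∃ δ : ℚ, 0 < δ ∧ ∀ R', IsProfile A R' → profileDist A R R' < δ →
      ∀ p ∈ choice A R', ∃ q ∈ choice A R, lotteryDist A p q < ε
  unanimity : ∀ x y : ℕ, ∀ R, IsProfile {x, y} R → pref {x, y} R x y = 1 →
    choice {x, y} R = {fun z => if z = x then 1 else 0}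
  decisive : ∀ A : Finset ℕ, A.Nonempty → ∀ R, IsProfile A R → ∀ ε : ℚ, 0 < ε →
    ∃ R', IsProfile A R' ∧ profileDist A R R' < ε ∧ ∃ p, choice A R' = {p}

/-- Population-consistency. -/
def PopulationConsistent (f : PSCF) : Prop :=
  ∀ A : Finset ℕ, A.Nonempty → ∀ R' R'', IsProfile A R' → IsProfile A R'' →
    ∀ l : ℚ, 0 ≤ l → l ≤ 1 →
      f.choice A R' ∩ f.choice A R'' ⊆ f.choice A (fun r => l * R' r + (1 - l) * R'' r)

/-- Composition-consistency. -/
def CompositionConsistent (f : PSCF) : Prop :=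
  ∀ A' B : Finset ℕ, ∀ b : ℕ, A' ∩ B = {b} →
    ∀ R, IsProfile (A' ∪ B) R → IsComponent (A' ∪ B) B R →
      f.choice (A' ∪ B) R =
        compSet B b (f.choice A' (restrictProfile (A' ∪ B) A' R))
          (f.choice B (restrictProfile (A' ∪ B) B R))

/-- The maximal-lotteries correspondence. -/
noncomputable def ML (A : Finset ℕ) (R : Finset (ℕ × ℕ) → ℚ) : Set (ℕ → ℚ) :=
  {p | IsLottery A p ∧ ∀ q, IsLottery A q →
    0 ≤ ∑ x ∈ A, ∑ y ∈ A, p x * margin A R x y * q y}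

/-- The uniform profile `uni(L(A))` on `A`. -/
noncomputable def uniProfile (A : Finset ℕ) : Finset (ℕ × ℕ) → ℚ :=
  fun r => if r ∈ linOrders A then ((Nat.factorial A.card : ℕ) : ℚ)⁻¹ else 0

/-- The uniform lottery `uni(A)` on `A`. -/
def uniLottery (A : Finset ℕ) : ℕ → ℚ :=
  fun x => if x ∈ A then (A.card : ℚ)⁻¹ else 0

/-- The degenerate lottery on `x`. -/
def degLottery (x : ℕ) : ℕ → ℚ := fun z => if z = x then 1 else 0

/-- `x` is a (weak) Condorcet winner in `R`. -/
def IsCondorcetWinner (A : Finset ℕ) (R : Finset (ℕ × ℕ) → ℚ) (x : ℕ) : Prop :=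
  x ∈ A ∧ ∀ y ∈ A, 0 ≤ margin A R x y

/-- `R` is regular on `A'`. -/
def Regular (A A' : Finset ℕ) (R : Finset (ℕ × ℕ) → ℚ) : Prop :=
  ∀ x ∈ A', (∑ y ∈ A', margin A R x y) = 0

/-- `R` is strongly regular on `A'`. -/
def StronglyRegular (A A' : Finset ℕ) (R : Finset (ℕ × ℕ) → ℚ) : Prop :=
  ∀ x ∈ A', ∀ y ∈ A', margin A R x y = 0

/-- Image of an order under a renaming `π`. -/
def mapOrder (π : ℕ → ℕ) (r : Finset (ℕ × ℕ)) : Finset (ℕ × ℕ) :=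
  r.image (fun xy => (π xy.1, π xy.2))

open Classical in
/-- The image `π(R)` of a profile on `A` under a renaming `π`. -/
noncomputable def mapProfile (π : ℕ → ℕ) (A : Finset ℕ) (R : Finset (ℕ × ℕ) → ℚ) :
    Finset (ℕ × ℕ) → ℚ :=
  fun s => ∑ r ∈ (linOrders A).filter (fun r => mapOrder π r = s), R r

open Classical in
/-- The image `π(p)` of a lottery on `A` under a renaming `π`. -/
noncomputable def mapLottery (π : ℕ → ℕ) (A : Finset ℕ) (p : ℕ → ℚ) : ℕ → ℚ :=
  fun y => ∑ x ∈ A.filter (fun x => π x = y), p x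

/-- The bound `ε_n = (4^n · ∏_{k=1}^n k!)⁻¹`. -/
noncomputable def epsN (n : ℕ) : ℚ :=
  (((4 ^ n * ∏ k ∈ Finset.Icc 1 n, Nat.factorial k : ℕ) : ℚ))⁻¹

abbrev V := Finset (ℕ × ℕ) → ℚ

/-- order as set of pairs of a list -/
def ord : List ℕ → Finset (ℕ × ℕ)
  | [] => ∅
  | a :: l => insert (a, a) (l.toFinset.image (fun y => (a, y)) ∪ ord l)

lemma mem_ord_nil (x y : ℕ) : (x, y) ∈ ord [] ↔ False := by simp [ord]

lemma mem_ord_cons (x y a : ℕ) (l : List ℕ) :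
    (x, y) ∈ ord (a :: l) ↔ (x = a ∧ (y = a ∨ y ∈ l)) ∨ (x, y) ∈ ord l := by
  simp only [ord, Finset.mem_insert, Finset.mem_union, Finset.mem_image, List.mem_toFinset,
    Prod.mk.injEq]
  grind

lemma mem_ord_mem {l : List ℕ} {x y : ℕ} (h : (x, y) ∈ ord l) : x ∈ l ∧ y ∈ l := by
  induction l with
  | nil => simp [ord] at h
  | cons a l ih => rw [mem_ord_cons] at h; grind

lemma mem_ord_append (x y : ℕ) (l m : List ℕ) :
    (x, y) ∈ ord (l ++ m) ↔ (x, y) ∈ ord l ∨ (x, y) ∈ ord m ∨ (x ∈ l ∧ y ∈ m) := by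
  induction l with
  | nil => simp [mem_ord_nil]
  | cons a l ih => rw [List.cons_append, mem_ord_cons, mem_ord_cons, ih]; grind

lemma mem_ord_reverse (x y : ℕ) (l : List ℕ) : (x, y) ∈ ord l.reverse ↔ (y, x) ∈ ord l := by
  induction l with
  | nil => simp [mem_ord_nil]
  | cons a l ih =>
    rw [List.reverse_cons, mem_ord_append, mem_ord_cons, ih, mem_ord_cons]
    simp only [mem_ord_nil, List.mem_reverse, List.mem_singleton, List.not_mem_nil]
    grind

lemma restrict_ord (B : Finset ℕ) (l : List ℕ) :
    restrictOrder B (ord l) = ord (l.filter (fun x => decide (x ∈ B))) := by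
  ext ⟨x, y⟩
  simp only [restrictOrder, Finset.mem_inter, Finset.mem_product]
  induction l with
  | nil => simp [mem_ord_nil]
  | cons a l ih =>
    rw [mem_ord_cons, List.filter_cons]
    by_cases ha : a ∈ B
    · simp only [ha, decide_true, if_true, mem_ord_cons, List.mem_filter, decide_eq_true_eq, ← ih]
      grind
    · simp only [ha, decide_false, Bool.false_eq_true, if_false, ← ih]
      grind

/-- `l` enumerates `A` without repetition -/
def Enum (A : Finset ℕ) (l : List ℕ) : Prop := l.Nodup ∧ ∀ x, x ∈ l ↔ x ∈ A

lemma ord_refl {l : List ℕ} {x : ℕ} (h : x ∈ l) : (x, x) ∈ ord l := by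
  induction l with
  | nil => simp at h
  | cons a l ih => rw [mem_ord_cons]; grind

lemma ord_total {l : List ℕ} {x y : ℕ} (h : x ∈ l) (h' : y ∈ l) :
    (x, y) ∈ ord l ∨ (y, x) ∈ ord l := by
  induction l with
  | nil => simp at h
  | cons a l ih => rw [mem_ord_cons, mem_ord_cons]; grind

lemma ord_trans {l : List ℕ} (hn : l.Nodup) {x y z : ℕ} (h : (x, y) ∈ ord l)
    (h' : (y, z) ∈ ord l) : (x, z) ∈ ord l := by
  induction l with
  | nil => simp [ord] at h
  | cons a l ih =>
    have := @mem_ord_mem l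
    rw [mem_ord_cons] at *; grind

lemma ord_antisymm {l : List ℕ} (hn : l.Nodup) {x y : ℕ} (h : (x, y) ∈ ord l)
    (h' : (y, x) ∈ ord l) : x = y := by
  induction l with
  | nil => simp [ord] at h
  | cons a l ih =>
    have := @mem_ord_mem l
    rw [mem_ord_cons] at *; grind

lemma ord_mem_linOrders {A : Finset ℕ} {l : List ℕ} (h : Enum A l) : ord l ∈ linOrders A := by
  obtain ⟨hn, hm⟩ := h
  have hs : ord l ⊆ A ×ˢ A := by
    rintro ⟨x, y⟩ hxy
    have := mem_ord_mem hxy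
    simp [← hm, this]
  simp only [linOrders, Finset.mem_filter, Finset.mem_powerset]
  refine ⟨hs, hs, ?_, ?_, ?_, ?_⟩
  · intro x hx; exact ord_refl ((hm x).2 hx)
  · intro x hx y hy; exact ord_total ((hm x).2 hx) ((hm y).2 hy)
  · intro x y z h h'; exact ord_trans hn h h'
  · intro x y h h'; exact ord_antisymm hn h h'

lemma ord_inj {l m : List ℕ} (hl : l.Nodup) (hm : m.Nodup) (h : ord l = ord m) : l = m := by
  have hmem : ∀ x, x ∈ l ↔ x ∈ m := fun x =>
    ⟨fun hx => (mem_ord_mem (h ▸ ord_refl hx)).1, fun hx => (mem_ord_mem (h ▸ ord_refl hx)).1⟩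
  have hp : l.Perm m := (List.perm_ext_iff_of_nodup hl hm).2 hmem
  have key : ∀ k : List ℕ, k.Pairwise (fun x y => (x, y) ∈ ord k) := by
    intro k
    induction k with
    | nil => simp
    | cons a k ih =>
      rw [List.pairwise_cons]
      refine ⟨fun b hb => by rw [mem_ord_cons]; grind, ih.imp ?_⟩
      intro x y hxy; rw [mem_ord_cons]; exact Or.inr hxy
  refine List.Perm.eq_of_pairwise (le := fun x y => (x, y) ∈ ord l) ?_ (key l) (h ▸ key m) hp
  intro a b _ _ h1 h2
  exact ord_antisymm hl h1 h2

/-- point mass -/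
def dl (l : List ℕ) : V := fun r => if r = ord l then 1 else 0

/-- weighted profile of lists -/
def prof {ι : Type} [Fintype ι] (w : ι → ℚ) (l : ι → List ℕ) : V := ∑ i, w i • dl (l i)

lemma prof_apply {ι : Type} [Fintype ι] (w : ι → ℚ) (l : ι → List ℕ) (r) :
    prof w l r = ∑ i, w i * (if r = ord (l i) then 1 else 0) := by
  simp [prof, dl]

lemma sum_prof {ι : Type} [Fintype ι] (w : ι → ℚ) (l : ι → List ℕ)
    (S : Finset (Finset (ℕ × ℕ))) :
    ∑ r ∈ S, prof w l r = ∑ i, w i * (if ord (l i) ∈ S then 1 else 0) := by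
  simp_rw [prof_apply]
  rw [Finset.sum_comm]
  refine Finset.sum_congr rfl fun i _ => ?_
  rw [← Finset.mul_sum, Finset.sum_ite_eq']

/-- validity of weights and lists -/
structure Val {ι : Type} [Fintype ι] (A : Finset ℕ) (w : ι → ℚ) (l : ι → List ℕ) : Prop where
  nn : ∀ i, 0 ≤ w i
  sm : ∑ i, w i = 1
  en : ∀ i, Enum A (l i)

lemma Val.isProfile {ι : Type} [Fintype ι] {A : Finset ℕ} {w : ι → ℚ} {l : ι → List ℕ}
    (h : Val A w l) : IsProfile A (prof w l) := by
  refine ⟨?_, ?_, ?_⟩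
  · intro r hr
    rw [prof_apply]
    refine Finset.sum_eq_zero fun i _ => ?_
    rw [if_neg, mul_zero]
    rintro rfl
    exact hr (ord_mem_linOrders (h.en i))
  · intro r
    rw [prof_apply]
    refine Finset.sum_nonneg fun i _ => mul_nonneg (h.nn i) ?_
    split_ifs <;> norm_num
  · rw [sum_prof]
    refine Eq.trans (Finset.sum_congr rfl fun i _ => ?_) h.sm
    rw [if_pos (ord_mem_linOrders (h.en i)), mul_one]

lemma restrict_prof {ι : Type} [Fintype ι] {A : Finset ℕ} (B : Finset ℕ) {w : ι → ℚ}
    {l : ι → List ℕ} (h : Val A w l) :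
    restrictProfile A B (prof w l) =
      prof w (fun i => (l i).filter (fun x => decide (x ∈ B))) := by
  funext s
  simp only [restrictProfile]
  rw [sum_prof, prof_apply]
  refine Finset.sum_congr rfl fun i _ => ?_
  simp only [Finset.mem_filter, ord_mem_linOrders (h.en i), true_and, restrict_ord, eq_comm]

lemma exists_of_prof_pos {ι : Type} [Fintype ι] {w : ι → ℚ} {l : ι → List ℕ} {r}
    (h : 0 < prof w l r) : ∃ i, r = ord (l i) := by
  by_contra hc
  push Not at hc
  rw [prof_apply] at h
  simp [hc] at h

/-- composition on list level -/
lemma comp_list {f : PSCF} (hcomp : CompositionConsistent f) {ι : Type} [Fintype ι]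
    (A B C : Finset ℕ) (b : ℕ) (hAB : C ∩ B = {b}) (hA : A = C ∪ B)
    (w : ι → ℚ) (u m v : ι → List ℕ) (h : Val A w (fun i => u i ++ m i ++ v i))
    (hm : ∀ i, ∀ x, x ∈ m i ↔ x ∈ B) :
    f.choice A (prof w (fun i => u i ++ m i ++ v i)) =
      compSet B b (f.choice C (prof w (fun i => u i ++ b :: v i)))
        (f.choice B (prof w m)) := by
  subst hA
  have hbB : ∀ x, x ∈ C → x ∈ B → x = b := by
    intro x h1 h2
    have : x ∈ C ∩ B := Finset.mem_inter.2 ⟨h1, h2⟩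
    rw [hAB] at this; simpa using this
  have hb : b ∈ C ∧ b ∈ B := by
    have : b ∈ C ∩ B := by rw [hAB]; simp
    simpa using this
  have hu : ∀ i, ∀ x ∈ u i, x ∈ C ∧ x ∉ B := by
    intro i x hx
    have h1 := (h.en i).1
    have h2 := ((h.en i).2 x).1 (by simp [hx])
    have h3 : x ∉ B := by
      rw [← hm i]; simp only [List.nodup_append] at h1; grind
    simp only [Finset.mem_union] at h2; tauto
  have hv : ∀ i, ∀ x ∈ v i, x ∈ C ∧ x ∉ B := by
    intro i x hx
    have h1 := (h.en i).1
    have h2 := ((h.en i).2 x).1 (by simp [hx])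
    have h3 : x ∉ B := by
      rw [← hm i]; simp only [List.nodup_append] at h1; grind
    simp only [Finset.mem_union] at h2; tauto
  rw [hcomp C B b hAB _ h.isProfile, restrict_prof _ h, restrict_prof _ h]
  · congr 2
    · congr 1
      funext i
      have h1 : (m i).filter (fun x => decide (x ∈ C)) = [b] := by
        have hn : (m i).Nodup := by
          have := (h.en i).1; simp only [List.nodup_append] at this; tauto
        have : ((m i).filter (fun x => decide (x ∈ C))).Perm [b] := by
          rw [List.perm_ext_iff_of_nodup (hn.filter _) (by simp)]
          intro x
          simp only [List.mem_filter, hm, decide_eq_true_eq, List.mem_singleton]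
          grind
        exact List.perm_singleton.1 this
      have h2 : (u i).filter (fun x => decide (x ∈ C)) = u i := by
        rw [List.filter_eq_self]; intro x hx; simp [hu i x hx]
      have h3 : (v i).filter (fun x => decide (x ∈ C)) = v i := by
        rw [List.filter_eq_self]; intro x hx; simp [hv i x hx]
      simp only [List.filter_append, h1, h2, h3]; simp
    · congr 1
      funext i
      have h1 : (m i).filter (fun x => decide (x ∈ B)) = m i := by
        rw [List.filter_eq_self]; intro x hx; simpa using (hm i x).1 hx
      have h2 : (u i).filter (fun x => decide (x ∈ B)) = [] := by
        rw [List.filter_eq_nil_iff]; intro x hx; simp [hu i x hx]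
      have h3 : (v i).filter (fun x => decide (x ∈ B)) = [] := by
        rw [List.filter_eq_nil_iff]; intro x hx; simp [hv i x hx]
      simp only [List.filter_append, h1, h2, h3]; simp
  · refine ⟨Finset.subset_union_right, ?_⟩
    intro a ha c hc c' hc' r hr hpos
    obtain ⟨i, rfl⟩ := exists_of_prof_pos hpos
    have ha' : a ∉ m i := by rw [hm]; simp at ha; tauto
    have hc1 : c ∉ u i ∧ c ∉ v i := ⟨fun h => (hu i c h).2 hc, fun h => (hv i c h).2 hc⟩
    have hc2 : c' ∉ u i ∧ c' ∉ v i := ⟨fun h => (hu i c' h).2 hc', fun h => (hv i c' h).2 hc'⟩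
    have e1 := (hm i c).2 hc
    have e2 := (hm i c').2 hc'
    have := @mem_ord_mem (u i)
    have := @mem_ord_mem (v i)
    have := @mem_ord_mem (m i)
    simp only [mem_ord_append, List.mem_append]
    grind

/-- one direction of composition, convenient form -/
lemma comp_mem {f : PSCF} (hcomp : CompositionConsistent f) {ι : Type} [Fintype ι]
    (A B C : Finset ℕ) (b : ℕ) (hAB : C ∩ B = {b}) (hA : A = C ∪ B)
    (w : ι → ℚ) (u m v : ι → List ℕ) (h : Val A w (fun i => u i ++ m i ++ v i))
    (hm : ∀ i, ∀ x, x ∈ m i ↔ x ∈ B) (p q s : ℕ → ℚ)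
    (hp : p ∈ f.choice C (prof w (fun i => u i ++ b :: v i)))
    (hq : q ∈ f.choice B (prof w m))
    (hs : ∀ x, s x = if x ∈ B then p b * q x else p x) :
    s ∈ f.choice A (prof w (fun i => u i ++ m i ++ v i)) := by
  rw [comp_list hcomp A B C b hAB hA w u m v h hm]
  exact ⟨p, hp, q, hq, funext hs⟩

lemma rename_list {f : PSCF} (hcomp : CompositionConsistent f) {ι : Type} [Fintype ι]
    (C : Finset ℕ) (a b : ℕ) (ha : a ∉ C) (hb : b ∉ C) (hab : a ≠ b)
    (w : ι → ℚ) (u v : ι → List ℕ) (h : Val (insert a C) w (fun i => u i ++ a :: v i))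
    (p p' : ℕ → ℚ) (hp : p ∈ f.choice (insert a C) (prof w (fun i => u i ++ a :: v i)))
    (hb' : p' b = p a) (ha' : p' a = 0) (hz : ∀ z, z ≠ a → z ≠ b → p' z = p z) :
    p' ∈ f.choice (insert b C) (prof w (fun i => u i ++ b :: v i)) := by
  have hx : ∀ i, b ∉ u i ∧ b ∉ v i ∧ a ∉ u i ∧ a ∉ v i := by
    intro i
    have h1 := (h.en i).2 b
    have h2 := (h.en i).1
    simp only [List.nodup_append, List.nodup_cons] at h2
    simp only [List.mem_append, List.mem_cons, Finset.mem_insert] at h1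
    grind
  have hV : Val (insert a (insert b C)) w (fun i => u i ++ [a, b] ++ v i) := by
    refine ⟨h.nn, h.sm, fun i => ⟨?_, fun x => ?_⟩⟩
    · have h2 := (h.en i).1
      have := hx i
      simp only [List.nodup_append, List.nodup_cons] at h2 ⊢
      grind
    · have h1 := (h.en i).2 x
      simp only [List.mem_append, List.mem_cons, Finset.mem_insert] at h1 ⊢
      grind
  have hV2 : Val (insert b C) w (fun i => u i ++ b :: v i) := by
    refine ⟨h.nn, h.sm, fun i => ⟨?_, fun x => ?_⟩⟩
    · have h2 := (h.en i).1
      have := hx i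
      simp only [List.nodup_append, List.nodup_cons] at h2 ⊢
      grind
    · have h1 := (h.en i).2 x
      have h2 := (h.en i).1
      simp only [List.nodup_append, List.nodup_cons] at h2
      have := hx i
      simp only [List.mem_append, List.mem_cons, Finset.mem_insert] at h1 ⊢
      grind
  have hm : ∀ i : ι, ∀ x, x ∈ [a, b] ↔ x ∈ ({a, b} : Finset ℕ) := by intro i x; simp
  have e1 := comp_list hcomp (insert a (insert b C)) {a, b} (insert a C) a
    (by ext x; simp only [Finset.mem_inter, Finset.mem_insert, Finset.mem_singleton]; grind)
    (by ext x; simp only [Finset.mem_union, Finset.mem_insert, Finset.mem_singleton]; grind)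
    w u (fun _ => [a, b]) v hV hm
  have e2 := comp_list hcomp (insert a (insert b C)) {a, b} (insert b C) b
    (by ext x; simp only [Finset.mem_inter, Finset.mem_insert, Finset.mem_singleton]; grind)
    (by ext x; simp only [Finset.mem_union, Finset.mem_insert, Finset.mem_singleton]; grind)
    w u (fun _ => [a, b]) v hV hm
  have hVab : Val {a, b} w (fun _ => [a, b]) :=
    ⟨h.nn, h.sm, fun i => ⟨by simp [hab], fun x => by simp⟩⟩
  obtain ⟨q, hq⟩ := f.nonempty {a, b} (by simp) _ hVab.isProfile
  have hmem : compLottery {a, b} a p q ∈ f.choice (insert a (insert b C))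
      (prof w (fun i => u i ++ [a, b] ++ v i)) := by
    rw [e1]; exact ⟨p, hp, q, hq, rfl⟩
  rw [e2] at hmem
  obtain ⟨p2, hp2, q2, hq2, he⟩ := hmem
  have l1 := f.subset_lotteries _ (by simp) _ hVab.isProfile hq
  have l2 := f.subset_lotteries _ (by simp) _ hVab.isProfile hq2
  have l3 := f.subset_lotteries _ (by simp) _ hV2.isProfile hp2
  have s1 := l1.2.2
  have s2 := l2.2.2
  rw [Finset.sum_pair hab] at s1 s2
  have : p' = p2 := by
    funext z
    by_cases hza : z = a
    · subst hza
      rw [ha', l3.1]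
      simp [hab, ha]
    by_cases hzb : z = b
    · subst hzb
      have g1 := congrFun he a
      have g2 := congrFun he z
      simp only [compLottery, Finset.mem_insert, Finset.mem_singleton, true_or, or_true,
        if_true] at g1 g2
      rw [hb']
      linear_combination g1 + g2 - p a * s1 + p2 z * s2
    · have g := congrFun he z
      simp only [compLottery, Finset.mem_insert, Finset.mem_singleton, hza, hzb, or_self,
        if_false] at g
      rw [hz z hza hzb, g]
  rw [this]; exact hp2

/-- lottery on a pair -/
def lot (a b : ℕ) (s : ℚ) : ℕ → ℚ := fun z => if z = a then s else if z = b then 1 - s else 0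

def pw (t : ℚ) : Bool → ℚ := fun c => if c then t else 1 - t

def pl (a b : ℕ) : Bool → List ℕ := fun c => if c then [a, b] else [b, a]

/-- `s` is a possible probability of `a` when weight `t` prefers `a` to `b` -/
def Pair (f : PSCF) (a b : ℕ) (t s : ℚ) : Prop :=
  lot a b s ∈ f.choice {a, b} (prof (pw t) (pl a b))

lemma pair_val {a b : ℕ} (hab : a ≠ b) {t : ℚ} (h0 : 0 ≤ t) (h1 : t ≤ 1) :
    Val {a, b} (pw t) (pl a b) := by
  refine ⟨?_, ?_, ?_⟩
  · intro c; cases c <;> simp [pw] <;> linarith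
  · simp [pw]
  · intro c; cases c
    · refine ⟨by simp [pl, hab.symm], fun x => ?_⟩
      simp [pl]; tauto
    · refine ⟨by simp [pl, hab], fun x => ?_⟩
      simp [pl]

lemma lot_of_lottery {a b : ℕ} (hab : a ≠ b) {p : ℕ → ℚ} (hp : IsLottery {a, b} p) :
    p = lot a b (p a) := by
  have h := hp.2.2
  rw [Finset.sum_pair hab] at h
  funext z
  simp only [lot]
  split_ifs with h1 h2
  · rw [h1]
  · rw [h2]; linarith
  · exact hp.1 z (by simp [h1, h2])

lemma pair_swap {f : PSCF} {a b : ℕ} (hab : a ≠ b) {t s : ℚ} (h : Pair f a b t s) :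
    Pair f b a (1 - t) (1 - s) := by
  unfold Pair at *
  have e1 : lot b a (1 - s) = lot a b s := by
    funext z; simp only [lot]; split_ifs <;> grind
  have e2 : prof (pw (1 - t)) (pl b a) = prof (pw t) (pl a b) := by
    simp [prof, pw, pl, add_comm]
  rw [e1, e2, Finset.pair_comm b a]; exact h

lemma pair_rename1 {f : PSCF} (hcomp : CompositionConsistent f) {a b c : ℕ} (hab : a ≠ b)
    (hcb : c ≠ b) (hac : a ≠ c)
    {t s : ℚ} (h0 : 0 ≤ t) (h1 : t ≤ 1) (h : Pair f a b t s) : Pair f c b t s := by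
  unfold Pair at *
  have E : ∀ x, pl x b = fun i => (fun i => if i then [] else [b]) i ++ x ::
    (fun i => if i = true then [b] else []) i := by
    intro x; funext i; cases i <;> simp [pl]
  have hv := pair_val hab h0 h1
  rw [E a] at h hv
  rw [E c]
  refine rename_list hcomp {b} a c (by simpa using hab) (by simpa using hcb) hac _ _ _ hv
    (lot a b s) _ h ?_ ?_ ?_
  · simp [lot]
  · simp [lot, hac, hab]
  · intro z hz hz'; simp [lot, hz, hz']

lemma pair_rename {f : PSCF} (hcomp : CompositionConsistent f) {a b c d : ℕ} (hab : a ≠ b)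
    (hcd : c ≠ d) {t s : ℚ} (h0 : 0 ≤ t) (h1 : t ≤ 1) (h : Pair f a b t s) :
    Pair f c d t s := by
  have r1 : ∀ {a b c : ℕ}, a ≠ b → c ≠ b → Pair f a b t s → Pair f c b t s := by
    intro a b c hab hcb h
    by_cases hac : a = c
    · subst hac; exact h
    · exact pair_rename1 hcomp hab hcb hac h0 h1 h
  have r2 : ∀ {a b c : ℕ}, a ≠ b → a ≠ c → Pair f a b t s → Pair f a c t s := by
    intro a b c hab hac h
    by_cases hbc : b = c
    · subst hbc; exact h
    · have := pair_swap hac.symm (pair_rename1 hcomp hab.symm hac.symm hbc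
        (by linarith) (by linarith) (pair_swap hab h))
      simpa using this
  have e : b ≠ a + b + c + d + 1 := by omega
  have e' : c ≠ a + b + c + d + 1 := by omega
  have e2 : a + b + c + d + 2 ≠ b := by omega
  have e3 : a + b + c + d + 2 ≠ a + b + c + d + 1 := by omega
  exact r2 e' hcd (r1 e3 e' (r2 e2 e3 (r1 hab e2 h)))

lemma pair_mul {f : PSCF} (hcomp : CompositionConsistent f) {t p q : ℚ} (h0 : 0 ≤ t)
    (h1 : t ≤ 1) (hp : Pair f 0 1 t p) (hq : Pair f 0 1 t q) : Pair f 0 1 t (p * q) := by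
  have hp' : Pair f 1 2 t p := pair_rename hcomp (by norm_num) (by norm_num) h0 h1 hp
  have hv1 : Val {0, 1, 2} (pw t) (fun i => (fun i => if i then [] else [2]) i ++ pl 0 1 i ++
      (fun i => if i = true then [2] else []) i) := by
    refine ⟨(pair_val (a := 0) (b := 1) (by norm_num) h0 h1).nn,
      (pair_val (a := 0) (b := 1) (by norm_num) h0 h1).sm, ?_⟩
    intro i; cases i <;> simp [pl, Enum] <;> grind
  have hv2 : Val {0, 1, 2} (pw t) (fun i => (fun i => if i then [0] else []) i ++ pl 1 2 i ++
      (fun i => if i = true then [] else [0]) i) := by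
    refine ⟨(pair_val (a := 0) (b := 1) (by norm_num) h0 h1).nn,
      (pair_val (a := 0) (b := 1) (by norm_num) h0 h1).sm, ?_⟩
    intro i; cases i <;> simp [pl, Enum] <;> grind
  have e1 := comp_list hcomp {0, 1, 2} {0, 1} {1, 2} 1 (by decide) (by decide) (pw t) _ _ _ hv1
    (by intro i x; cases i <;> simp [pl] <;> tauto)
  have e2 := comp_list hcomp {0, 1, 2} {1, 2} {0, 1} 1 (by decide) (by decide) (pw t) _ _ _ hv2
    (by intro i x; cases i <;> simp [pl] <;> tauto)
  have E : (fun i => (fun i => if i then [] else [2]) i ++ pl 0 1 i ++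
      (fun i => if i = true then [2] else []) i) = (fun i => (fun i => if i then [0] else []) i ++
      pl 1 2 i ++ (fun i => if i = true then [] else [0]) i) := by
    funext i; cases i <;> simp [pl]
  rw [E, e2] at e1
  have E1 : (fun i => (fun i => if i then [] else [2]) i ++ 1 ::
      (fun i => if i = true then [2] else []) i) = pl 1 2 := by
    funext i; cases i <;> simp [pl]
  have E2 : (fun i => (fun i => if i then [0] else []) i ++ 1 ::
      (fun i => if i = true then [] else [0]) i) = pl 0 1 := by
    funext i; cases i <;> simp [pl]
  rw [E1, E2] at e1
  have hmem : compLottery {0, 1} 1 (lot 1 2 p) (lot 0 1 q) ∈ compSet {0, 1} 1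
      (f.choice {1, 2} (prof (pw t) (pl 1 2))) (f.choice {0, 1} (prof (pw t) (pl 0 1))) :=
    ⟨_, hp', _, hq, rfl⟩
  rw [← e1] at hmem
  obtain ⟨p', hp', q', hq', he⟩ := hmem
  have hl := f.subset_lotteries _ (by simp) _
    (pair_val (a := 0) (b := 1) (by norm_num) h0 h1).isProfile hp'
  have g := congrFun he 0
  simp [compLottery, lot] at g
  unfold Pair
  rw [g, ← lot_of_lottery (by norm_num) hl]
  exact hp'

lemma pair_convex {f : PSCF} {a b : ℕ} (hab : a ≠ b) {t : ℚ} (h0 : 0 ≤ t) (h1 : t ≤ 1)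
    {p q s : ℚ} (hp : Pair f a b t p) (hq : Pair f a b t q) (h : p ≤ s) (h' : s ≤ q) :
    Pair f a b t s := by
  rcases eq_or_lt_of_le (h.trans h') with e | e
  · have : s = p := by linarith
    rw [this]; exact hp
  · have hd : 0 < q - p := by linarith
    have := f.convex _ (by simp) _ (pair_val hab h0 h1).isProfile _ hp _ hq ((q - s) / (q - p))
      (div_nonneg (by linarith) hd.le) (by rw [div_le_one hd]; linarith)
    unfold Pair
    convert this using 1
    funext z
    simp only [lot]
    have hne := hd.ne'
    split_ifs
    · field_simp; ring
    · field_simp; ring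
    · ring

lemma pair_half {f : PSCF} (hcomp : CompositionConsistent f) {a b : ℕ} (hab : a ≠ b) {s : ℚ}
    (h0 : 0 < s) (h1 : s < 1) : Pair f a b (1 / 2) s := by
  suffices h : Pair f 0 1 (1 / 2) s from
    pair_rename hcomp (by norm_num) hab (by norm_num) (by norm_num) h
  have v := pair_val (a := 0) (b := 1) (t := 1 / 2) (by norm_num) (by norm_num) (by norm_num)
  obtain ⟨p, hp⟩ := f.nonempty {0, 1} (by simp) _ v.isProfile
  have hl := f.subset_lotteries _ (by simp) _ v.isProfile hp
  rw [lot_of_lottery (by norm_num) hl] at hp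
  have sw : ∀ x, Pair f 0 1 (1 / 2) x → Pair f 0 1 (1 / 2) (1 - x) := by
    intro x hx
    have := pair_rename (c := 0) (d := 1) hcomp (by norm_num) (by norm_num) (by norm_num)
      (by norm_num) (pair_swap (by norm_num) hx)
    norm_num at this ⊢; exact this
  have hp' : Pair f 0 1 (1 / 2) (p 0) := hp
  have half : Pair f 0 1 (1 / 2) (1 / 2) := by
    rcases le_total (p 0) (1 / 2) with h | h
    · exact pair_convex (by norm_num) (by norm_num) (by norm_num) hp' (sw _ hp') h (by linarith)
    · exact pair_convex (by norm_num) (by norm_num) (by norm_num) (sw _ hp') hp' (by linarith) h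
  have pow : ∀ n : ℕ, Pair f 0 1 (1 / 2) ((1 / 2) ^ (n + 1)) := by
    intro n
    induction n with
    | zero => simpa using half
    | succ n ih => rw [pow_succ]; exact pair_mul hcomp (by norm_num) (by norm_num) ih half
  obtain ⟨n, hn⟩ := exists_pow_lt_of_lt_one h0 (show (1 / 2 : ℚ) < 1 by norm_num)
  obtain ⟨m, hm⟩ := exists_pow_lt_of_lt_one (sub_pos.2 h1) (show (1 / 2 : ℚ) < 1 by norm_num)
  refine pair_convex (by norm_num) (by norm_num) (by norm_num) (pow n) (sw _ (pow m)) ?_ ?_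
  · refine le_trans ?_ hn.le
    rw [pow_succ]; have : (0 : ℚ) < (1 / 2) ^ n := by positivity
    linarith
  · have : (0 : ℚ) < (1 / 2) ^ m := by positivity
    rw [pow_succ]; linarith

lemma prof_const {ι : Type} [Fintype ι] (w : ι → ℚ) (l : List ℕ) (hw : ∑ i, w i = 1) :
    prof w (fun _ => l) = dl l := by
  simp [prof, ← Finset.sum_smul, hw]

lemma pref_prof {ι : Type} [Fintype ι] {A : Finset ℕ} {w : ι → ℚ} {l : ι → List ℕ}
    (h : Val A w l) (x y : ℕ) : pref A (prof w l) x y =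
      ∑ i, w i * (if (x, y) ∈ ord (l i) ∧ (y, x) ∉ ord (l i) then 1 else 0) := by
  simp only [pref]
  rw [sum_prof]
  refine Finset.sum_congr rfl fun i _ => ?_
  simp only [Finset.mem_filter, ord_mem_linOrders (h.en i), true_and]

lemma unan {f : PSCF} {a b : ℕ} (hab : a ≠ b) :
    f.choice {a, b} (dl [a, b]) = {fun z => if z = a then 1 else 0} := by
  have v : Val {a, b} (fun _ : Unit => (1 : ℚ)) (fun _ => [a, b]) :=
    ⟨by simp, by simp, fun _ => ⟨by simp [hab], by simp⟩⟩
  rw [← prof_const (fun _ : Unit => (1 : ℚ)) [a, b] (by simp)]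
  refine f.unanimity a b _ v.isProfile ?_
  rw [pref_prof v]
  simp [mem_ord_cons, mem_ord_nil, hab, hab.symm]

lemma pair_one {f : PSCF} {a b : ℕ} (hab : a ≠ b) : Pair f a b 1 1 := by
  have : prof (pw 1) (pl a b) = dl [a, b] := by simp [prof, pw, pl]
  unfold Pair
  rw [this, unan hab]
  simp only [Set.mem_singleton_iff]
  funext z; simp [lot]

lemma linOrders01 : linOrders {0, 1} = {ord [0, 1], ord [1, 0]} := by
  apply Finset.Subset.antisymm
  · intro r hr
    simp only [linOrders, Finset.mem_filter, Finset.mem_powerset] at hr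
    obtain ⟨-, hs, h1, h2, -, h4⟩ := hr
    have hs' : ∀ x y, (x, y) ∈ r → (x = 0 ∨ x = 1) ∧ (y = 0 ∨ y = 1) := by
      intro x y h; have := hs h; simpa using this
    have a0 := h1 0 (by simp)
    have a1 := h1 1 (by simp)
    have a2 := h2 0 (by simp) 1 (by simp)
    have a3 := h4 0 1
    simp only [Finset.mem_insert, Finset.mem_singleton]
    rcases a2 with a2 | a2
    · left; ext ⟨x, y⟩; simp only [mem_ord_cons, mem_ord_nil]; have := hs' x y; grind
    · right; ext ⟨x, y⟩; simp only [mem_ord_cons, mem_ord_nil]; have := hs' x y; grind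
  · intro r hr
    have v := pair_val (a := 0) (b := 1) (t := 1) (by norm_num) (by norm_num) (by norm_num)
    simp only [Finset.mem_insert, Finset.mem_singleton] at hr
    rcases hr with rfl | rfl
    · exact ord_mem_linOrders (v.en true)
    · exact ord_mem_linOrders (v.en false)

lemma ord01_ne : ord [0, 1] ≠ ord [1, 0] := by decide

lemma exists_t0 {f : PSCF} (hcomp : CompositionConsistent f) :
    ∃ t : ℚ, 0 ≤ t ∧ t < 1 ∧ Pair f 0 1 t 1 := by
  have v1 := pair_val (a := 0) (b := 1) (t := 1) (by norm_num) (by norm_num) (by norm_num)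
  have e1 : prof (pw 1) (pl 0 1) = dl [0, 1] := by simp [prof, pw, pl]
  have pa : ∀ t, prof (pw t) (pl 0 1) (ord [0, 1]) = t ∧
      prof (pw t) (pl 0 1) (ord [1, 0]) = 1 - t := by
    intro t; simp [prof_apply, pw, pl, ord01_ne, ord01_ne.symm]
  obtain ⟨δ, hδ, hc⟩ := f.continuity {0, 1} (by simp) _ v1.isProfile 1 one_pos
  set η : ℚ := min δ 1 / 8 with hη
  have hη0 : 0 < η := by rw [hη]; positivity
  have hη1 : 8 * η ≤ δ := by have := min_le_left δ 1; rw [hη]; linarith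
  have hη2 : 8 * η ≤ 1 := by have := min_le_right δ 1; rw [hη]; linarith
  have v2 := pair_val (a := 0) (b := 1) (t := 1 - η) (by norm_num) (by linarith) (by linarith)
  obtain ⟨R, hR, hd, p, hp⟩ := f.decisive {0, 1} (by simp) _ v2.isProfile η hη0
  obtain ⟨R1, R2, R3⟩ := hR
  rw [linOrders01, Finset.sum_pair ord01_ne] at R3
  have hRt : R = prof (pw (R (ord [0, 1]))) (pl 0 1) := by
    funext r
    by_cases h1 : r = ord [0, 1]
    · rw [h1, (pa _).1]
    by_cases h2 : r = ord [1, 0]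
    · rw [h2, (pa _).2]; linarith
    · rw [R1 r (by rw [linOrders01]; simp [h1, h2]), prof_apply]
      simp [pl, h1, h2]
  have t0 := R2 (ord [0, 1])
  have t1 := R2 (ord [1, 0])
  set t := R (ord [0, 1]) with ht
  have ht1 : t ≤ 1 := by linarith
  simp only [profileDist] at hd
  rw [linOrders01, Finset.sum_pair ord01_ne, (pa _).1, (pa _).2, ← ht] at hd
  have b1 := abs_lt.1 (lt_of_le_of_lt (le_add_of_nonneg_right (abs_nonneg _)) hd)
  have b2 := abs_lt.1 (lt_of_le_of_lt (le_add_of_nonneg_left (abs_nonneg _)) hd)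
  have b3 := le_abs_self (1 - η - t)
  have b4 := neg_le_abs (1 - η - t)
  have b5 := le_abs_self (1 - (1 - η) - R (ord [1, 0]))
  have b6 := neg_le_abs (1 - (1 - η) - R (ord [1, 0]))
  have ht2 : t < 1 := by linarith
  have v := pair_val (a := 0) (b := 1) (t := t) (by norm_num) t0 ht1
  obtain ⟨q, hq, hdist⟩ := hc R (hRt ▸ v.isProfile) (by
    simp only [profileDist]
    rw [linOrders01, Finset.sum_pair ord01_ne, (pa _).1, (pa _).2, ← ht,
      abs_of_nonneg (by linarith), abs_of_nonpos (by linarith)]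
    linarith) p (by rw [hp]; rfl)
  rw [e1, unan (by norm_num)] at hq
  rw [hRt] at hp
  have hl := f.subset_lotteries _ (by simp) _ v.isProfile (show p ∈ _ by rw [hp]; rfl)
  have hpl := lot_of_lottery (by norm_num) hl
  have hP : Pair f 0 1 t (p 0) := by unfold Pair; rw [hp, ← hpl]; rfl
  have hP2 := pair_mul hcomp t0 ht1 hP hP
  unfold Pair at hP2
  rw [hp] at hP2
  have := congrFun hP2 0
  simp only [lot, if_true] at this
  have h01 : p 0 = 0 ∨ p 0 = 1 := by
    have : p 0 * (p 0 - 1) = 0 := by linear_combination this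
    rcases mul_eq_zero.1 this with h | h
    · exact Or.inl h
    · exact Or.inr (by linarith)
  refine ⟨t, t0, ht2, ?_⟩
  rcases h01 with h | h
  · exfalso
    rw [hq, lotteryDist, Finset.sum_pair (by norm_num), h] at hdist
    have := abs_nonneg (p 1 - (if (1 : ℕ) = 0 then 1 else 0))
    norm_num at hdist
    linarith [abs_nonneg (p 1)]
  · rw [← h]; exact hP

/-- pop consistency -/
lemma pop_mem {f : PSCF} (hpop : PopulationConsistent f) {A : Finset ℕ} (hA : A.Nonempty)
    {R R' : V} (h : IsProfile A R) (h' : IsProfile A R') {p : ℕ → ℚ} (hp : p ∈ f.choice A R)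
    (hp' : p ∈ f.choice A R') {t : ℚ} (h0 : 0 ≤ t) (h1 : t ≤ 1) :
    p ∈ f.choice A (t • R + (1 - t) • R') :=
  hpop A hA R R' h h' t h0 h1 ⟨hp, hp'⟩

lemma pair_top {f : PSCF} (hpop : PopulationConsistent f) (hcomp : CompositionConsistent f)
    {t0 : ℚ} (h0 : 0 ≤ t0) (h1 : t0 < 1) (h : Pair f 0 1 t0 1) {a b : ℕ} (hab : a ≠ b) {t : ℚ}
    (ht : t0 ≤ t) (ht1 : t ≤ 1) : Pair f a b t 1 := by
  have h2 := pair_rename hcomp (by norm_num) hab h0 h1.le h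
  have h3 := pair_one (f := f) hab
  have hd : 0 < 1 - t0 := by linarith
  have := pop_mem hpop (by simp) (pair_val hab h0 h1.le).isProfile
    (pair_val hab (by norm_num) (by norm_num)).isProfile h2 h3 (t := (1 - t) / (1 - t0))
    (div_nonneg (by linarith) hd.le) (by rw [div_le_one hd]; linarith)
  unfold Pair
  convert this using 2
  funext r
  have hne := hd.ne'
  simp only [prof, pw, pl, Fintype.sum_bool, Pi.add_apply, Pi.smul_apply, smul_eq_mul, if_true,
    Bool.false_eq_true, if_false]
  field_simp
  ring

/-- lottery on a triple -/
def trilot (a b c : ℕ) (p q r : ℚ) : ℕ → ℚ :=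
  fun z => if z = a then p else if z = b then q else if z = c then r else 0

def trip (a b c : ℕ) : Fin 3 → List ℕ := ![[a, b, c], [b, c, a], [c, a, b]]

def Tri (f : PSCF) (a b c : ℕ) (p q r : ℚ) : Prop :=
  trilot a b c p q r ∈ f.choice {a, b, c} (prof (fun _ => (1 / 3 : ℚ)) (trip a b c))

lemma tri_val {a b c : ℕ} (hab : a ≠ b) (hac : a ≠ c) (hbc : b ≠ c) :
    Val {a, b, c} (fun _ => (1 / 3 : ℚ)) (trip a b c) := by
  refine ⟨by norm_num, by simp, fun i => ?_⟩
  fin_cases i <;> simp [trip, Enum] <;> grind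

lemma tri_rot {f : PSCF} {a b c : ℕ} {p q r : ℚ} (hab : a ≠ b) (hac : a ≠ c) (hbc : b ≠ c)
    (h : Tri f a b c p q r) : Tri f b c a q r p := by
  unfold Tri at *
  have e1 : trilot b c a q r p = trilot a b c p q r := by
    funext z; simp only [trilot]; split_ifs <;> grind
  have e2 : prof (fun _ => (1 / 3 : ℚ)) (trip b c a) = prof (fun _ => (1 / 3 : ℚ)) (trip a b c) := by
    simp only [prof, trip, Fin.sum_univ_three, Matrix.cons_val]
    abel
  have e3 : ({b, c, a} : Finset ℕ) = {a, b, c} := by ext; simp; tauto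
  rw [e1, e2, e3]; exact h

lemma tri_rename {f : PSCF} (hcomp : CompositionConsistent f) {a b c d : ℕ} {p q r : ℚ}
    (hab : a ≠ b) (hac : a ≠ c) (hbc : b ≠ c) (hda : d ≠ a) (hdb : d ≠ b) (hdc : d ≠ c)
    (h : Tri f a b c p q r) : Tri f d b c p q r := by
  unfold Tri at *
  have E : ∀ x, trip x b c = fun i => (![[], [b, c], [c]] : Fin 3 → List ℕ) i ++ x ::
      (![[b, c], [], [b]] : Fin 3 → List ℕ) i := by
    intro x; funext i; fin_cases i <;> simp [trip]
  have hv := tri_val hab hac hbc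
  rw [E a] at h hv
  rw [E d]
  refine rename_list hcomp {b, c} a d (by simp [hab, hac]) (by simp [hdb, hdc]) hda.symm _ _ _ hv
    _ _ h ?_ ?_ ?_
  · simp [trilot]
  · simp [trilot, hda.symm, hab, hac]
  · intro z hz hz'; simp [trilot, hz, hz']

lemma tri_cycle {f : PSCF} (hcomp : CompositionConsistent f) {a b c : ℕ} {p q r : ℚ}
    (hab : a ≠ b) (hac : a ≠ c) (hbc : b ≠ c) (h : Tri f a b c p q r) : Tri f a b c q r p := by
  obtain ⟨d, hda, hdb, hdc⟩ : ∃ d, d ≠ a ∧ d ≠ b ∧ d ≠ c :=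
    ⟨a + b + c + 1, by omega, by omega, by omega⟩
  have h1 := tri_rot hdb hdc hbc (tri_rename hcomp hab hac hbc hda hdb hdc h)
  have h2 := tri_rot hac hda.symm hdc.symm
    (tri_rename hcomp hbc hdb.symm hdc.symm hab hac hda.symm h1)
  have h3 := tri_rot hdb.symm hab.symm hda
    (tri_rename hcomp hdc.symm hac.symm hda hbc hdb.symm hab.symm h2)
  have h4 := tri_rename hcomp hda hdb hab hdc.symm hac.symm hbc.symm h3
  exact tri_rot hac.symm hbc.symm hab h4

lemma tri_uni {f : PSCF} (hcomp : CompositionConsistent f) {a b c : ℕ}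
    (hab : a ≠ b) (hac : a ≠ c) (hbc : b ≠ c) : Tri f a b c (1 / 3) (1 / 3) (1 / 3) := by
  have v := (tri_val hab hac hbc).isProfile
  obtain ⟨p, hp⟩ := f.nonempty _ (by simp) _ v
  have hl := f.subset_lotteries _ (by simp) _ v hp
  have hs := hl.2.2
  rw [Finset.sum_insert (by simp [hab, hac]), Finset.sum_pair hbc] at hs
  have h1 : Tri f a b c (p a) (p b) (p c) := by
    unfold Tri
    convert hp using 1
    funext z
    simp only [trilot]
    split_ifs with e1 e2 e3
    · rw [e1]
    · rw [e2]
    · rw [e3]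
    · exact (hl.1 z (by simp [e1, e2, e3])).symm
  have h2 := tri_cycle hcomp hab hac hbc h1
  have h3 := tri_cycle hcomp hab hac hbc h2
  have h4 := f.convex _ (by simp) _ v _ h1 _ h2 (1 / 2) (by norm_num) (by norm_num)
  have h5 := f.convex _ (by simp) _ v _ h4 _ h3 (2 / 3) (by norm_num) (by norm_num)
  unfold Tri
  convert h5 using 1
  funext z
  simp only [trilot]
  split_ifs <;> linarith

def sy (l : List ℕ) : Bool → List ℕ := fun c => if c then l else l.reverse

lemma sy_val {A : Finset ℕ} {l : List ℕ} (h : Enum A l) : Val A (pw (1 / 2)) (sy l) := by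
  refine ⟨?_, ?_, ?_⟩
  · intro c; cases c <;> norm_num [pw]
  · simp [pw]
  · intro c; cases c
    · exact ⟨by simpa [sy] using h.1, fun x => by simpa [sy] using h.2 x⟩
    · simpa [sy] using h

lemma sym_pos {f : PSCF} (hcomp : CompositionConsistent f) : ∀ (l : List ℕ) (A : Finset ℕ),
    l ≠ [] → Enum A l → ∀ p, IsLottery A p → (∀ x ∈ A, 0 < p x) →
      p ∈ f.choice A (prof (pw (1 / 2)) (sy l)) := by
  intro l
  induction l with
  | nil => intro A h; exact absurd rfl h
  | cons x l ih =>
    intro A _ hl p hp hpos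
    have v := (sy_val hl).isProfile
    have hAne : A.Nonempty := ⟨x, (hl.2 x).1 (by simp)⟩
    cases l with
    | nil =>
      have hA : A = {x} := by ext z; rw [← hl.2]; simp
      subst hA
      obtain ⟨q, hq⟩ := f.nonempty _ hAne _ v
      have hql := f.subset_lotteries _ hAne _ v hq
      have : p = q := by
        funext z
        by_cases hz : z = x
        · have h1 := hp.2.2
          have h2 := hql.2.2
          simp only [Finset.sum_singleton] at h1 h2
          rw [hz, h1, h2]
        · rw [hp.1 z (by simpa using hz), hql.1 z (by simpa using hz)]
      rw [this]; exact hq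
    | cons y m =>
      have hn := hl.1
      have hx : x ∉ y :: m := (List.nodup_cons.1 hn).1
      have hxy : x ≠ y := by rintro rfl; simp at hx
      set B := (y :: m).toFinset with hB
      have hBm : ∀ z, z ∈ y :: m ↔ z ∈ B := fun z => by simp [hB]
      have hEB : Enum B (y :: m) := ⟨(List.nodup_cons.1 hn).2, hBm⟩
      have hxB : x ∉ B := by rw [← hBm]; exact hx
      have hAB : A = insert x B := by
        ext z; rw [← hl.2, Finset.mem_insert, ← hBm, List.mem_cons]
      have hsum := hp.2.2
      rw [hAB, Finset.sum_insert hxB] at hsum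
      have hyB : y ∈ B := by rw [← hBm]; simp
      have hBpos : 0 < ∑ z ∈ B, p z :=
        Finset.sum_pos (fun z hz => hpos z (by rw [hAB]; simp [hz])) ⟨y, hyB⟩
      have hpx := hpos x (by rw [hAB]; simp)
      have hd : 1 - p x ≠ 0 := by linarith
      have hq := ih B (by simp) hEB (fun z => if z ∈ B then p z / (1 - p x) else 0)
        ⟨fun z hz => by simp [hz], fun z => by
          dsimp only
          split_ifs with h
          · exact div_nonneg (hp.2.1 z) (by linarith)
          · exact le_rfl, by
          rw [Finset.sum_congr rfl (fun z hz => if_pos hz), ← Finset.sum_div,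
            div_eq_one_iff_eq hd]; linarith⟩
        (fun z hz => by
          simp only [hz, if_true]
          exact div_pos (hpos z (by rw [hAB]; simp [hz])) (by linarith))
      have E : sy (x :: y :: m) = fun c => (fun c => if c then [x] else []) c ++ sy (y :: m) c ++
          (fun c => if c = true then [] else [x]) c := by
        funext c; cases c <;> simp [sy]
      have hv := sy_val hl
      rw [E] at hv ⊢
      refine comp_mem hcomp A B {x, y} y ?_ ?_ _ _ _ _ hv ?_ (lot x y (p x)) _ p ?_ hq ?_
      · ext z; simp only [Finset.mem_inter, Finset.mem_insert, Finset.mem_singleton]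
        grind
      · rw [hAB]; ext z; simp only [Finset.mem_union, Finset.mem_insert, Finset.mem_singleton]
        grind
      · intro c z; rw [← hBm]; cases c <;> simp [sy]; tauto
      · have := pair_half (f := f) hcomp hxy hpx (by linarith)
        unfold Pair at this
        convert this using 3
        funext c
        cases c <;> simp [pl]
      · intro z
        by_cases hz : z ∈ B
        · simp only [hz, if_true, lot, hxy.symm, if_false]
          field_simp
        · simp only [hz, if_false, lot]
          by_cases hzx : z = x
          · simp [hzx]
          · have : z ≠ y := by rintro rfl; exact hz hyB
            simp [hzx, this]
            exact hp.1 z (by rw [hAB]; simp [hz, hzx])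

lemma deg_top {f : PSCF} (hcomp : CompositionConsistent f) {ι : Type} [Fintype ι]
    (D : Finset ℕ) (hD : D.Nonempty) (b : ℕ) (hb : b ∉ D) (w : ι → ℚ) (t : ι → List ℕ)
    (h : Val D w t) : degLottery b ∈ f.choice (insert b D) (prof w (fun i => b :: t i)) := by
  obtain ⟨d, hd⟩ := hD
  have hbd : b ≠ d := by rintro rfl; exact hb hd
  obtain ⟨q, hq⟩ := f.nonempty D ⟨d, hd⟩ _ h.isProfile
  have hv : Val (insert b D) w (fun i => (fun _ => [b]) i ++ t i ++ (fun _ => []) i) := by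
    refine ⟨h.nn, h.sm, fun i => ⟨?_, fun x => ?_⟩⟩
    · have := (h.en i).1
      have h2 := (h.en i).2 b
      simp only [List.append_nil, List.singleton_append, List.nodup_cons]
      tauto
    · simp [(h.en i).2]
  have := comp_mem hcomp (insert b D) D {b, d} d (by
      ext z; simp only [Finset.mem_inter, Finset.mem_insert, Finset.mem_singleton]; grind)
    (by ext z; simp only [Finset.mem_union, Finset.mem_insert, Finset.mem_singleton]; grind)
    w _ _ _ hv (fun i x => (h.en i).2 x) (degLottery b) q (degLottery b) (by
      change degLottery b ∈ f.choice {b, d} (prof w (fun _ => [b, d]))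
      rw [prof_const w _ h.sm, unan hbd]; rfl) hq (by
      intro x
      by_cases hx : x ∈ D
      · have : x ≠ b := by rintro rfl; exact hb hx
        simp [hx, degLottery, this, hbd.symm]
      · simp [hx])
  simpa using this

lemma lift_top {f : PSCF} (hcomp : CompositionConsistent f) {ι : Type} [Fintype ι]
    (S D : Finset ℕ) (hS : S.Nonempty) (hd : Disjoint S D) (w : ι → ℚ) (s t : ι → List ℕ)
    (hs : Val S w s) (ht : Val D w t) (p : ℕ → ℚ) (hp : p ∈ f.choice S (prof w s)) :
    p ∈ f.choice (S ∪ D) (prof w (fun i => s i ++ t i)) := by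
  have hd' : ∀ x, x ∈ S → x ∉ D := fun x h h' => Finset.disjoint_left.1 hd h h'
  rcases D.eq_empty_or_nonempty with rfl | hD
  · have : ∀ i, t i = [] := by
      intro i; rw [List.eq_nil_iff_forall_not_mem]; intro x hx
      simpa using ((ht.en i).2 x).1 hx
    simpa [this] using hp
  obtain ⟨b, hb⟩ := hS
  have hv : Val (S ∪ D) w (fun i => (fun _ => []) i ++ s i ++ t i) := by
    refine ⟨hs.nn, hs.sm, fun i => ⟨?_, fun x => ?_⟩⟩
    · have := (hs.en i)
      have h2 := (ht.en i)
      simp only [List.nil_append, List.nodup_append]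
      refine ⟨this.1, h2.1, ?_⟩
      rintro x hx y hy rfl
      exact hd' x ((this.2 x).1 hx) ((h2.2 x).1 hy)
    · simp [(hs.en i).2, (ht.en i).2]
  have hl := f.subset_lotteries S ⟨b, hb⟩ _ hs.isProfile hp
  have := comp_mem hcomp (S ∪ D) S (insert b D) b (by
      ext z; simp only [Finset.mem_inter, Finset.mem_insert, Finset.mem_singleton]; grind)
    (by ext z; simp only [Finset.mem_union, Finset.mem_insert]; grind)
    w _ _ _ hv (fun i x => (hs.en i).2 x) (degLottery b) p p
    (deg_top hcomp D hD b (hd' b hb) w t ht) hp (by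
      intro x
      by_cases hx : x ∈ S
      · simp [hx, degLottery]
      · have : x ≠ b := by rintro rfl; exact hx hb
        simp [hx, degLottery, this, hl.1 x hx])
  simpa using this

/-- indicator of strict preference -/
def ind (l : List ℕ) (x y : ℕ) : ℚ := if (x, y) ∈ ord l ∧ (y, x) ∉ ord l then 1 else 0

/-- Borda-like score -/
def bo (S : Finset ℕ) (l : List ℕ) (x : ℕ) : ℚ := ∑ y ∈ S, (ind l x y - ind l y x)

lemma regular_prof {ι : Type} [Fintype ι] {A S : Finset ℕ} {w : ι → ℚ} {l : ι → List ℕ}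
    (h : Val A w l) (hz : ∀ x ∈ S, ∑ i, w i * bo S (l i) x = 0) : Regular A S (prof w l) := by
  intro x hx
  rw [← hz x hx]
  simp only [margin, pref_prof h, bo, ind, Finset.mul_sum]
  rw [Finset.sum_comm]
  refine Finset.sum_congr rfl fun y _ => ?_
  rw [← Finset.sum_sub_distrib]
  refine Finset.sum_congr rfl fun i _ => ?_
  ring

lemma bo_reverse (S : Finset ℕ) (l : List ℕ) (x : ℕ) : bo S l.reverse x = - bo S l x := by
  rw [bo, bo, ← Finset.sum_neg_distrib]
  refine Finset.sum_congr rfl fun y _ => ?_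
  simp only [ind, mem_ord_reverse]
  ring

lemma bo_append (S : Finset ℕ) (s t : List ℕ) (x : ℕ) (hx : x ∈ S) (h : ∀ y ∈ t, y ∉ S) :
    bo S (s ++ t) x = bo S s x := by
  rw [bo, bo]
  refine Finset.sum_congr rfl fun y hy => ?_
  have := @mem_ord_mem t
  simp only [ind, mem_ord_append]
  congr 2 <;> grind

lemma bo_drop (S : Finset ℕ) (u v : List ℕ) (x y : ℕ) (hx : x ∈ S) (h : y ∉ S) :
    bo S (u ++ y :: v) x = bo S (u ++ v) x := by
  rw [bo, bo]
  refine Finset.sum_congr rfl fun z hz => ?_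
  simp only [ind, mem_ord_append, mem_ord_cons, List.mem_cons]
  congr 2 <;> grind

lemma bo_swap (S : Finset ℕ) (u v : List ℕ) (x y a : ℕ) (hx : x ∈ S) (hy : y ∈ S)
    (hn : (u ++ x :: y :: v).Nodup) :
    bo S (u ++ x :: y :: v) a - bo S (u ++ y :: x :: v) a =
      2 * ((if a = x then 1 else 0) - (if a = y then 1 else 0)) := by
  have key : ∀ z ∈ S, (ind (u ++ x :: y :: v) a z - ind (u ++ x :: y :: v) z a) -
      (ind (u ++ y :: x :: v) a z - ind (u ++ y :: x :: v) z a) =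
      2 * ((if z = y then (if a = x then 1 else 0) else 0) -
        (if z = x then (if a = y then 1 else 0) else 0)) := by
    intro z hz
    have h1 := @mem_ord_mem u
    have h2 := @mem_ord_mem v
    simp only [List.nodup_append, List.nodup_cons, List.mem_cons] at hn
    by_cases c1 : a = x ∧ z = y
    · obtain ⟨rfl, rfl⟩ := c1
      have e1 : ind (u ++ a :: z :: v) a z = 1 := by
        rw [ind, if_pos]; simp only [mem_ord_append, mem_ord_cons, List.mem_cons]; grind
      have e2 : ind (u ++ a :: z :: v) z a = 0 := by
        rw [ind, if_neg]; simp only [mem_ord_append, mem_ord_cons, List.mem_cons]; grind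
      have e3 : ind (u ++ z :: a :: v) z a = 1 := by
        rw [ind, if_pos]; simp only [mem_ord_append, mem_ord_cons, List.mem_cons]; grind
      have e4 : ind (u ++ z :: a :: v) a z = 0 := by
        rw [ind, if_neg]; simp only [mem_ord_append, mem_ord_cons, List.mem_cons]; grind
      have : a ≠ z := by grind
      rw [e1, e2, e3, e4]; simp [this, this.symm]; norm_num
    by_cases c2 : a = y ∧ z = x
    · obtain ⟨rfl, rfl⟩ := c2
      have e1 : ind (u ++ a :: z :: v) a z = 1 := by
        rw [ind, if_pos]; simp only [mem_ord_append, mem_ord_cons, List.mem_cons]; grind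
      have e2 : ind (u ++ a :: z :: v) z a = 0 := by
        rw [ind, if_neg]; simp only [mem_ord_append, mem_ord_cons, List.mem_cons]; grind
      have e3 : ind (u ++ z :: a :: v) z a = 1 := by
        rw [ind, if_pos]; simp only [mem_ord_append, mem_ord_cons, List.mem_cons]; grind
      have e4 : ind (u ++ z :: a :: v) a z = 0 := by
        rw [ind, if_neg]; simp only [mem_ord_append, mem_ord_cons, List.mem_cons]; grind
      have : a ≠ z := by grind
      rw [e1, e2, e3, e4]; simp [this, this.symm]; norm_num
    · have m : ∀ a z, ¬ (a = x ∧ z = y) → ¬ (a = y ∧ z = x) →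
          ((a, z) ∈ ord (u ++ x :: y :: v) ↔ (a, z) ∈ ord (u ++ y :: x :: v)) := by
        intro a z d1 d2
        simp only [mem_ord_append, mem_ord_cons, List.mem_cons]; grind
      have m1 := m a z c1 c2
      have m2 := m z a (by tauto) (by tauto)
      simp only [ind, m1, m2]
      split_ifs <;> simp_all
  rw [bo, bo, ← Finset.sum_sub_distrib, Finset.sum_congr rfl key, ← Finset.mul_sum,
    Finset.sum_sub_distrib, Finset.sum_ite_eq', Finset.sum_ite_eq', if_pos hx, if_pos hy]

/-- the good profiles -/
def Kp (f : PSCF) (A S : Finset ℕ) : Set V :=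
  {R | IsProfile A R ∧ Regular A S R ∧ uniLottery S ∈ f.choice A R}

lemma uni_lottery (S : Finset ℕ) (hS : S.Nonempty) : IsLottery S (uniLottery S) := by
  have : (S.card : ℚ) ≠ 0 := by exact_mod_cast hS.card_ne_zero
  refine ⟨fun x hx => by simp [uniLottery, hx], fun x => ?_, ?_⟩
  · simp only [uniLottery]; split_ifs <;> positivity
  · simp only [uniLottery]
    rw [Finset.sum_congr rfl (fun z hz => if_pos hz)]
    simp [this]

lemma lift_K {f : PSCF} (hcomp : CompositionConsistent f) {ι : Type} [Fintype ι]
    (S D : Finset ℕ) (hS : S.Nonempty) (hd : Disjoint S D) (w : ι → ℚ) (s t : ι → List ℕ)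
    (hs : Val S w s) (ht : ∀ i, Enum D (t i)) (hp : uniLottery S ∈ f.choice S (prof w s))
    (hz : ∀ x ∈ S, ∑ i, w i * bo S (s i) x = 0) :
    prof w (fun i => s i ++ t i) ∈ Kp f (S ∪ D) S := by
  have hd' : ∀ x, x ∈ S → x ∉ D := fun x h h' => Finset.disjoint_left.1 hd h h'
  have htv : Val D w t := ⟨hs.nn, hs.sm, ht⟩
  have hv : Val (S ∪ D) w (fun i => s i ++ t i) := by
    refine ⟨hs.nn, hs.sm, fun i => ⟨?_, fun x => ?_⟩⟩
    · have := (hs.en i)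
      have h2 := (htv.en i)
      simp only [List.nodup_append]
      refine ⟨this.1, h2.1, ?_⟩
      rintro x hx y hy rfl
      exact hd' x ((this.2 x).1 hx) ((h2.2 x).1 hy)
    · simp [(hs.en i).2, (htv.en i).2]
  refine ⟨hv.isProfile, regular_prof hv ?_, lift_top hcomp S D hS hd w s t hs htv _ hp⟩
  intro x hx
  rw [← hz x hx]
  refine Finset.sum_congr rfl fun i _ => ?_
  rw [bo_append S _ _ x hx]
  intro y hy h
  exact hd' y h ((ht i).2 y |>.1 hy)

lemma uni_pos (S : Finset ℕ) : ∀ x ∈ S, 0 < uniLottery S x := by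
  intro x hx
  have : 0 < S.card := Finset.card_pos.2 ⟨x, hx⟩
  simp [uniLottery, hx]
  exact ⟨x, hx⟩

lemma Enum.ne_nil {S : Finset ℕ} {s : List ℕ} (h : Enum S s) (hS : S.Nonempty) : s ≠ [] := by
  rintro rfl
  obtain ⟨x, hx⟩ := hS
  simpa using (h.2 x).2 hx

lemma K1 {f : PSCF} (hcomp : CompositionConsistent f) (S D : Finset ℕ) (hS : S.Nonempty)
    (hd : Disjoint S D) (s t t' : List ℕ) (hs : Enum S s) (ht : Enum D t) (ht' : Enum D t') :
    (1 / 2 : ℚ) • dl (s ++ t) + (1 / 2 : ℚ) • dl (s.reverse ++ t') ∈ Kp f (S ∪ D) S := by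
  have := lift_K (f := f) hcomp S D hS hd (pw (1 / 2)) (sy s) (fun c => if c then t else t')
    (sy_val hs) (by intro i; cases i <;> simpa)
    (sym_pos hcomp s S (hs.ne_nil hS) hs _ (uni_lottery S hS) (uni_pos S))
    (by intro x hx; simp [pw, sy, bo_reverse]; ring)
  convert this using 1
  simp [prof, pw, sy]
  norm_num

lemma K2 {f : PSCF} (hpop : PopulationConsistent f) (hcomp : CompositionConsistent f)
    (S D : Finset ℕ) (hS : S.Nonempty)
    (hd : Disjoint S D) (u v u' v' : List ℕ) (x y : ℕ) (t : List ℕ)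
    (h1 : Enum S (u ++ x :: y :: v)) (h2 : Enum S (u' ++ x :: y :: v')) (ht : Enum D t) :
    (1 / 4 : ℚ) • dl (u ++ x :: y :: v ++ t) +
      (1 / 4 : ℚ) • dl (v.reverse ++ x :: y :: u.reverse ++ t) +
      (1 / 4 : ℚ) • dl (u' ++ y :: x :: v' ++ t) +
      (1 / 4 : ℚ) • dl (v'.reverse ++ y :: x :: u'.reverse ++ t) ∈ Kp f (S ∪ D) S := by
  have n1 := h1.1
  have n2 := h2.1
  have m1 := h1.2
  have m2 := h2.2
  simp only [List.nodup_append, List.nodup_cons, List.mem_cons] at n1 n2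
  simp only [List.mem_append, List.mem_cons] at m1 m2
  have hxy : x ≠ y := by grind
  have hxS : x ∈ S := by grind
  have hyS : y ∈ S := by grind
  have e1 : Enum (S.erase y) (u ++ x :: v) := by
    refine ⟨?_, fun z => ?_⟩
    · simp only [List.nodup_append, List.nodup_cons, List.mem_cons]; grind
    · simp only [List.mem_append, List.mem_cons, Finset.mem_erase]; grind
  have e2 : Enum (S.erase y) (u' ++ x :: v') := by
    refine ⟨?_, fun z => ?_⟩
    · simp only [List.nodup_append, List.nodup_cons, List.mem_cons]; grind
    · simp only [List.mem_append, List.mem_cons, Finset.mem_erase]; grind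
  have hv : Val S (fun _ : Fin 4 => (1 / 4 : ℚ)) (fun i =>
      (![u, v.reverse, u', v'.reverse] : Fin 4 → List ℕ) i ++
      (![[x, y], [x, y], [y, x], [y, x]] : Fin 4 → List ℕ) i ++
      (![v, u.reverse, v', u'.reverse] : Fin 4 → List ℕ) i) := by
    refine ⟨by norm_num, by simp, fun i => ⟨?_, fun z => ?_⟩⟩
    · fin_cases i <;>
      simp only [List.nodup_append, List.nodup_cons, List.mem_cons, List.nodup_reverse,
        List.mem_append, List.mem_reverse, Fin.zero_eta, Fin.mk_one, Fin.reduceFinMk,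
        Matrix.cons_val] <;> grind
    · fin_cases i <;>
      simp only [List.mem_cons, 
        List.mem_append, List.mem_reverse, Fin.zero_eta, Fin.mk_one, Fin.reduceFinMk,
        Matrix.cons_val] <;> grind
  have hk : (0 : ℚ) < S.card := by exact_mod_cast hS.card_pos
  have hC : (S.erase y).Nonempty := ⟨x, by simp [hxy, hxS]⟩
  set p : ℕ → ℚ := fun z => if z = x then 2 * (S.card : ℚ)⁻¹ else
    if z ∈ S.erase y then (S.card : ℚ)⁻¹ else 0 with hp
  have hpl : IsLottery (S.erase y) p := by
    refine ⟨fun z hz => ?_, fun z => ?_, ?_⟩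
    · have : z ≠ x := by rintro rfl; simp [hxy, hxS] at hz
      simp only [hp, this, hz, if_false]
    · simp only [hp]; split_ifs <;> positivity
    · have hx' : x ∈ S.erase y := by simp [hxy, hxS]
      rw [← Finset.add_sum_erase _ _ hx']
      have : ∑ z ∈ (S.erase y).erase x, p z = ∑ z ∈ (S.erase y).erase x, (S.card : ℚ)⁻¹ := by
        refine Finset.sum_congr rfl fun z hz => ?_
        have h := Finset.mem_erase.1 hz
        simp only [hp, h.1, h.2, if_true, if_false]
      rw [this]
      have c1 := Finset.card_erase_add_one hyS
      have c2 := Finset.card_erase_add_one hx'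
      have c3 : (((S.erase y).erase x).card : ℚ) = S.card - 2 := by
        rw [← c1, ← c2]; push_cast; ring
      simp only [hp, if_true, Finset.sum_const, nsmul_eq_mul, c3]
      field_simp; ring
  have hpp : ∀ z ∈ S.erase y, 0 < p z := by
    intro z hz; simp only [hp, hz, if_true]; split_ifs <;> positivity
  have q1 := sym_pos (f := f) hcomp _ _ (e1.ne_nil hC) e1 p hpl hpp
  have q2 := sym_pos (f := f) hcomp _ _ (e2.ne_nil hC) e2 p hpl hpp
  have q3 := pop_mem hpop hC (sy_val e1).isProfile (sy_val e2).isProfile q1 q2 (t := 1 / 2)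
    (by norm_num) (by norm_num)
  have hU : uniLottery S ∈ f.choice S (prof (fun _ : Fin 4 => (1 / 4 : ℚ)) (fun i =>
      (![u, v.reverse, u', v'.reverse] : Fin 4 → List ℕ) i ++
      (![[x, y], [x, y], [y, x], [y, x]] : Fin 4 → List ℕ) i ++
      (![v, u.reverse, v', u'.reverse] : Fin 4 → List ℕ) i)) := by
    refine comp_mem hcomp S {x, y} (S.erase y) x ?_ ?_ _ _ _ _ hv ?_ p (lot x y (1 / 2)) _ ?_ ?_ ?_
    · ext z; simp only [Finset.mem_inter, Finset.mem_insert, Finset.mem_singleton,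
        Finset.mem_erase]; grind
    · ext z; simp only [Finset.mem_union, Finset.mem_insert, Finset.mem_singleton,
        Finset.mem_erase]; grind
    · intro i z; fin_cases i <;> simp <;> tauto
    · convert q3 using 2
      simp only [prof, Fin.sum_univ_four, pw, sy, Fintype.sum_bool, Matrix.cons_val, if_true,
        Bool.false_eq_true, if_false, List.reverse_append, List.reverse_cons, List.append_assoc,
        List.singleton_append]
      module
    · have := pair_half (f := f) hcomp hxy (s := 1 / 2) (by norm_num) (by norm_num)
      unfold Pair at this
      convert this using 2
      simp only [prof, Fin.sum_univ_four, pw, pl, Fintype.sum_bool, Matrix.cons_val, if_true,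
        Bool.false_eq_true, if_false]
      module
    · intro z
      simp only [uniLottery, Finset.mem_insert, Finset.mem_singleton, hp, lot, Finset.mem_erase]
      by_cases hzx : z = x
      · subst hzx; simp [hxS]; ring
      · by_cases hzy : z = y
        · subst hzy; simp [hyS, hzx]; ring
        · simp [hzx, hzy]
  have := lift_K (f := f) hcomp S D hS hd _ _ (fun _ => t) hv (fun _ => ht) hU (by
    intro a ha
    have b1 := bo_reverse S (u ++ y :: x :: v) a
    have b2 := bo_reverse S (u' ++ x :: y :: v') a
    have b3 := bo_swap S u v x y a hxS hyS h1.1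
    have b4 := bo_swap S u' v' x y a hxS hyS h2.1
    simp only [List.reverse_append, List.reverse_cons, List.append_assoc,
        List.cons_append, List.nil_append] at b1 b2
    simp only [Fin.sum_univ_four, Matrix.cons_val, List.append_assoc, List.cons_append,
      List.nil_append]
    rw [b1, b2]
    linarith)
  convert this using 1
  simp only [prof, Fin.sum_univ_four, Matrix.cons_val, List.append_assoc, List.cons_append,
      List.nil_append]

lemma K3 {f : PSCF} (hcomp : CompositionConsistent f)
    (S D : Finset ℕ) (hS : S.Nonempty)
    (hd : Disjoint S D) (v : List ℕ) (x y z : ℕ) (t : List ℕ)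
    (h1 : Enum S (x :: y :: z :: v)) (ht : Enum D t) :
    (1 / 6 : ℚ) • dl (x :: y :: z :: v ++ t) + (1 / 6 : ℚ) • dl (y :: z :: x :: v ++ t) +
      (1 / 6 : ℚ) • dl (z :: x :: y :: v ++ t) +
      (1 / 6 : ℚ) • dl (v.reverse ++ [x, y, z] ++ t) +
      (1 / 6 : ℚ) • dl (v.reverse ++ [y, z, x] ++ t) +
      (1 / 6 : ℚ) • dl (v.reverse ++ [z, x, y] ++ t) ∈ Kp f (S ∪ D) S := by
  have n1 := h1.1
  have m1 := h1.2
  simp only [List.nodup_cons, List.mem_cons] at n1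
  simp only [List.mem_cons] at m1
  have hxy : x ≠ y := by grind
  have hxz : x ≠ z := by grind
  have hyz : y ≠ z := by grind
  have hxS : x ∈ S := by grind
  have hyS : y ∈ S := by grind
  have hzS : z ∈ S := by grind
  set C := (S.erase y).erase z with hCdef
  have hxC : x ∈ C := by simp [hCdef, hxy, hxz, hxS]
  have e1 : Enum C (x :: v) := by
    refine ⟨?_, fun z => ?_⟩
    · simp only [List.nodup_cons]; grind
    · simp only [List.mem_cons, hCdef, Finset.mem_erase]; grind
  have hv : Val S (fun _ : Fin 6 => (1 / 6 : ℚ)) (fun i =>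
      (![[], [], [], v.reverse, v.reverse, v.reverse] : Fin 6 → List ℕ) i ++
      (![[x, y, z], [y, z, x], [z, x, y], [x, y, z], [y, z, x], [z, x, y]] : Fin 6 → List ℕ) i ++
      (![v, v, v, [], [], []] : Fin 6 → List ℕ) i) := by
    refine ⟨by norm_num, by simp, fun i => ⟨?_, fun z => ?_⟩⟩
    · fin_cases i <;>
      simp only [List.nodup_append, List.nodup_cons, List.mem_cons, List.nodup_reverse,
        List.mem_append, List.mem_reverse, Fin.zero_eta, Fin.mk_one, Fin.reduceFinMk,
        Matrix.cons_val] <;> grind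
    · fin_cases i <;>
      simp only [List.mem_cons, 
        List.mem_append, List.mem_reverse, Fin.zero_eta, Fin.mk_one, Fin.reduceFinMk,
        Matrix.cons_val] <;> grind
  have hk : (0 : ℚ) < S.card := by exact_mod_cast hS.card_pos
  have hC : C.Nonempty := ⟨x, hxC⟩
  set p : ℕ → ℚ := fun z => if z = x then 3 * (S.card : ℚ)⁻¹ else
    if z ∈ C then (S.card : ℚ)⁻¹ else 0 with hp
  have hpl : IsLottery C p := by
    refine ⟨fun z hz => ?_, fun z => ?_, ?_⟩
    · have : z ≠ x := by rintro rfl; exact hz hxC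
      simp only [hp, this, hz, if_false]
    · simp only [hp]; split_ifs <;> positivity
    · rw [← Finset.add_sum_erase _ _ hxC]
      have : ∑ z ∈ C.erase x, p z = ∑ z ∈ C.erase x, (S.card : ℚ)⁻¹ := by
        refine Finset.sum_congr rfl fun z hz => ?_
        have h := Finset.mem_erase.1 hz
        simp only [hp, h.1, h.2, if_true, if_false]
      rw [this]
      have c0 := Finset.card_erase_add_one hyS
      have c1 := Finset.card_erase_add_one (show z ∈ S.erase y by simp [hyz.symm, hzS])
      have c2 := Finset.card_erase_add_one hxC
      have c3 : ((C.erase x).card : ℚ) = S.card - 3 := by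
        rw [← c0, ← c1, ← c2]; push_cast; ring
      simp only [hp, if_true, Finset.sum_const, nsmul_eq_mul, c3]
      field_simp; ring
  have hpp : ∀ z ∈ C, 0 < p z := by
    intro z hz; simp only [hp, hz, if_true]; split_ifs <;> positivity
  have q1 := sym_pos (f := f) hcomp _ _ (e1.ne_nil hC) e1 p hpl hpp
  have hU : uniLottery S ∈ f.choice S (prof (fun _ : Fin 6 => (1 / 6 : ℚ)) (fun i =>
      (![[], [], [], v.reverse, v.reverse, v.reverse] : Fin 6 → List ℕ) i ++
      (![[x, y, z], [y, z, x], [z, x, y], [x, y, z], [y, z, x], [z, x, y]] : Fin 6 → List ℕ) i ++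
      (![v, v, v, [], [], []] : Fin 6 → List ℕ) i)) := by
    refine comp_mem hcomp S {x, y, z} C x ?_ ?_ _ _ _ _ hv ?_ p
      (trilot x y z (1 / 3) (1 / 3) (1 / 3)) _ ?_ ?_ ?_
    · ext z; simp only [Finset.mem_inter, Finset.mem_insert, Finset.mem_singleton, hCdef,
        Finset.mem_erase]; grind
    · ext z; simp only [Finset.mem_union, Finset.mem_insert, Finset.mem_singleton, hCdef,
        Finset.mem_erase]; grind
    · intro i z; fin_cases i <;> simp <;> tauto
    · convert q1 using 2
      simp only [prof, Fin.sum_univ_six, pw, sy, Fintype.sum_bool, Matrix.cons_val, if_true,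
        Bool.false_eq_true, if_false, List.reverse_cons, List.nil_append]
      module
    · have := tri_uni (f := f) hcomp hxy hxz hyz
      unfold Tri at this
      convert this using 2
      simp only [prof, Fin.sum_univ_six, Fin.sum_univ_three, trip, Matrix.cons_val]
      module
    · intro a
      simp only [uniLottery, Finset.mem_insert, Finset.mem_singleton, hp, trilot, hCdef,
        Finset.mem_erase]
      by_cases hzx : a = x
      · subst hzx; simp [hxS]; ring
      · by_cases hzy : a = y
        · subst hzy; simp [hyS, hzx]; ring
        · by_cases hzz : a = z
          · subst hzz; simp [hzS, hzx, hzy]; ring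
          · simp [hzx, hzy, hzz]
  have := lift_K (f := f) hcomp S D hS hd _ _ (fun _ => t) hv (fun _ => ht) hU (by
    intro a ha
    have b1 := bo_reverse S (z :: y :: x :: v) a
    have b2 := bo_reverse S (x :: z :: y :: v) a
    have b3 := bo_reverse S (y :: x :: z :: v) a
    have g1 := bo_swap S [] (z :: v) x y a hxS hyS (by simp; grind)
    have g2 := bo_swap S [y] v x z a hxS hzS (by simp; grind)
    have g3 := bo_swap S [] (x :: v) y z a hyS hzS (by simp; grind)
    have g4 := bo_swap S [z] v y x a hyS hxS (by simp; grind)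
    have g5 := bo_swap S [] (y :: v) x z a hxS hzS (by simp; grind)
    have g6 := bo_swap S [x] v y z a hyS hzS (by simp; grind)
    simp only [List.reverse_cons, List.append_assoc, List.nil_append, List.cons_append,
        List.nil_append] at b1 b2 b3 g1 g2 g3 g4 g5 g6
    simp only [Fin.sum_univ_six, Matrix.cons_val, List.append_assoc, List.cons_append,
      List.nil_append]
    rw [b1, b2, b3]
    linarith)
  convert this using 1
  simp only [prof, Fin.sum_univ_six, Matrix.cons_val, List.append_assoc, List.cons_append,
      List.nil_append]

lemma KC {f : PSCF} (hpop : PopulationConsistent f) (hcomp : CompositionConsistent f)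
    {t0 : ℚ} (h0 : 0 ≤ t0) (h1 : t0 < 1) (h : Pair f 0 1 t0 1) {ι : Type} [Fintype ι]
    (C S : Finset ℕ) (hSC : S ⊆ C) (x y : ℕ) (hx : x ∈ S) (hy : y ∉ C) (w : ι → ℚ)
    (u v : ι → List ℕ) (hV : Val C w (fun i => u i ++ x :: v i))
    (hK : prof w (fun i => u i ++ x :: v i) ∈ Kp f C S)
    (hreg : ∀ a ∈ S, ∑ i, w i * bo S (u i ++ x :: v i) a = 0)
    (τ : ι → ℚ) (hτ0 : ∀ i, t0 ≤ τ i) (hτ1 : ∀ i, τ i ≤ 1) :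
    Val (insert y C) (fun i : ι × Bool => w i.1 * pw (τ i.1) i.2)
      (fun i => u i.1 ++ pl x y i.2 ++ v i.1) ∧
    prof (fun i : ι × Bool => w i.1 * pw (τ i.1) i.2) (fun i => u i.1 ++ pl x y i.2 ++ v i.1)
      ∈ Kp f (insert y C) S ∧
    (∀ a ∈ S, ∑ i : ι × Bool, w i.1 * pw (τ i.1) i.2 * bo S (u i.1 ++ pl x y i.2 ++ v i.1) a = 0)
      := by
  have hxC := hSC hx
  have hyS : y ∉ S := fun hh => hy (hSC hh)
  have hxy : x ≠ y := by rintro rfl; exact hy hxC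
  have hv : Val (insert y C) (fun i : ι × Bool => w i.1 * pw (τ i.1) i.2)
      (fun i => u i.1 ++ pl x y i.2 ++ v i.1) := by
    refine ⟨fun i => ?_, ?_, fun i => ?_⟩
    · refine mul_nonneg (hV.nn _) ?_
      have := hτ0 i.1
      have := hτ1 i.1
      simp only [pw]; split_ifs <;> linarith
    · rw [Fintype.sum_prod_type, ← hV.sm]
      refine Finset.sum_congr rfl fun i _ => ?_
      simp [pw]; ring
    · obtain ⟨i, c⟩ := i
      have n1 := (hV.en i).1
      have m1 := (hV.en i).2
      simp only [List.nodup_append, List.nodup_cons, List.mem_cons] at n1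
      simp only [List.mem_append, List.mem_cons] at m1
      refine ⟨?_, fun z => ?_⟩
      · cases c <;> simp only [pl, if_true, Bool.false_eq_true, if_false, List.nodup_append,
          List.nodup_cons, List.mem_cons, List.mem_append] <;> grind
      · cases c <;> simp only [pl, if_true, Bool.false_eq_true, if_false, 
          List.mem_cons, List.mem_append, Finset.mem_insert] <;> grind
  have hreg' : ∀ a ∈ S, ∑ i : ι × Bool, w i.1 * pw (τ i.1) i.2 *
      bo S (u i.1 ++ pl x y i.2 ++ v i.1) a = 0 := by
    intro a ha
    rw [Fintype.sum_prod_type, ← hreg a ha]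
    refine Finset.sum_congr rfl fun i _ => ?_
    have b1 : bo S (u i ++ pl x y true ++ v i) a = bo S (u i ++ x :: v i) a := by
      have := bo_drop S (u i ++ [x]) (v i) a y ha hyS
      simpa [pl] using this
    have b2 : bo S (u i ++ pl x y false ++ v i) a = bo S (u i ++ x :: v i) a := by
      have := bo_drop S (u i) (x :: v i) a y ha hyS
      simpa [pl] using this
    rw [Fintype.sum_bool, b1, b2]
    simp [pw]; ring
  have sumτ0 : t0 ≤ ∑ i, w i * τ i := by
    calc t0 = ∑ i, w i * t0 := by rw [← Finset.sum_mul, hV.sm, one_mul]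
      _ ≤ _ := Finset.sum_le_sum fun i _ => mul_le_mul_of_nonneg_left (hτ0 i) (hV.nn i)
  have sumτ1 : ∑ i, w i * τ i ≤ 1 := by
    calc ∑ i, w i * τ i ≤ ∑ i, w i := Finset.sum_le_sum fun i _ =>
          mul_le_of_le_one_right (hV.nn i) (hτ1 i)
      _ = 1 := hV.sm
  refine ⟨hv, ⟨hv.isProfile, regular_prof hv hreg', ?_⟩, hreg'⟩
  refine comp_mem hcomp (insert y C) {x, y} C x ?_ ?_ _ (fun i : ι × Bool => u i.1)
    (fun i => pl x y i.2) (fun i => v i.1) hv ?_ (uniLottery S) (lot x y 1) _ ?_ ?_ ?_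
  · ext z; simp only [Finset.mem_inter, Finset.mem_insert, Finset.mem_singleton]; grind
  · ext z; simp only [Finset.mem_union, Finset.mem_insert, Finset.mem_singleton]; grind
  · rintro ⟨i, c⟩ z; cases c <;> simp [pl]; tauto
  · convert hK.2.2 using 2
    simp only [prof, Fintype.sum_prod_type, Fintype.sum_bool]
    refine Finset.sum_congr rfl fun i _ => ?_
    simp only [pw, if_true, Bool.false_eq_true, if_false]
    module
  · have := pair_top hpop hcomp h0 h1 h hxy sumτ0 sumτ1
    unfold Pair at this
    convert this using 2
    simp only [prof, Fintype.sum_prod_type, Fintype.sum_bool, pw, pl, if_true,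
      Bool.false_eq_true, if_false]
    rw [Finset.sum_add_distrib, ← Finset.sum_smul, ← Finset.sum_smul]
    congr 2
    simp only [mul_sub, mul_one, Finset.sum_sub_distrib, hV.sm]
  · intro z
    simp only [Finset.mem_insert, Finset.mem_singleton, lot]
    by_cases hzx : z = x
    · simp [hzx]
    · by_cases hzy : z = y
      · subst hzy; simp [uniLottery, hyS, hzx]
      · simp [hzx, hzy]

lemma Enum.perm {A : Finset ℕ} {l m : List ℕ} (h : Enum A l) (p : l.Perm m) : Enum A m :=
  ⟨p.nodup_iff.1 h.1, fun x => by rw [← p.mem_iff]; exact h.2 x⟩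

lemma adj_split (P : ℕ → Prop) : ∀ l : List ℕ, (∃ x ∈ l, P x) → (∃ y ∈ l, ¬ P y) →
    ∃ u a b v, l = u ++ a :: b :: v ∧ ((P a ∧ ¬ P b) ∨ (¬ P a ∧ P b)) := by
  intro l
  induction l with
  | nil => rintro ⟨x, hx, _⟩; simp at hx
  | cons c m ih =>
    intro h1 h2
    cases m with
    | nil =>
      obtain ⟨x, hx, hP⟩ := h1
      obtain ⟨y, hy, hQ⟩ := h2
      simp only [List.mem_singleton] at hx hy
      subst hx; subst hy; exact absurd hP hQ
    | cons d m =>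
      by_cases hx : (P c ∧ ¬ P d) ∨ (¬ P c ∧ P d)
      · exact ⟨[], c, d, m, rfl, hx⟩
      · have h1' : ∃ x ∈ d :: m, P x := by
          obtain ⟨x, hx', hP⟩ := h1
          rcases List.mem_cons.1 hx' with rfl | hm
          · exact ⟨d, by simp, by tauto⟩
          · exact ⟨x, hm, hP⟩
        have h2' : ∃ x ∈ d :: m, ¬ P x := by
          obtain ⟨x, hx', hP⟩ := h2
          rcases List.mem_cons.1 hx' with rfl | hm
          · exact ⟨d, by simp, by tauto⟩
          · exact ⟨x, hm, hP⟩
        obtain ⟨u, a, b, v, e, h⟩ := ih h1' h2'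
        exact ⟨c :: u, a, b, v, by rw [e]; rfl, h⟩

def Good (f : PSCF) (A S : Finset ℕ) (l0 : List ℕ) : Prop :=
  ∃ (ι : Type) (_ : Fintype ι) (w : ι → ℚ) (l : ι → List ℕ), Val A w l ∧ prof w l ∈ Kp f A S ∧
    (∀ a ∈ S, ∑ i, w i * bo S (l i) a = 0) ∧ ∃ i0, l i0 = l0 ∧ 0 < w i0

def GoodAt (f : PSCF) (C S : Finset ℕ) (x : ℕ) (u v : List ℕ) : Prop :=
  ∃ (ι : Type) (_ : Fintype ι) (w : ι → ℚ) (us vs : ι → List ℕ),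
    Val C w (fun i => us i ++ x :: vs i) ∧ prof w (fun i => us i ++ x :: vs i) ∈ Kp f C S ∧
    (∀ a ∈ S, ∑ i, w i * bo S (us i ++ x :: vs i) a = 0) ∧
    ∃ i0, us i0 = u ∧ vs i0 = v ∧ 0 < w i0

lemma Good.at {f : PSCF} {C S : Finset ℕ} {x : ℕ} {u v : List ℕ} (hx : x ∈ C)
    (h : Good f C S (u ++ x :: v)) : GoodAt f C S x u v := by
  obtain ⟨ι, _, w, l, hV, hK, hr, i0, e, hw⟩ := h
  have : ∀ i, ∃ p : List ℕ × List ℕ, l i = p.1 ++ x :: p.2 ∧ (i = i0 → p = (u, v)) := by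
    intro i
    by_cases hi : i = i0
    · exact ⟨(u, v), by rw [hi, e], fun _ => rfl⟩
    · obtain ⟨s, t, h⟩ := List.append_of_mem (((hV.en i).2 x).2 hx)
      exact ⟨(s, t), h, fun h => absurd h hi⟩
  choose p hp hp0 using this
  obtain rfl : l = fun i => (p i).1 ++ x :: (p i).2 := funext hp
  exact ⟨ι, _, w, fun i => (p i).1, fun i => (p i).2, hV, hK, hr, i0, by simp [hp0 i0 rfl],
    by simp [hp0 i0 rfl], hw⟩

lemma GoodAt.left {f : PSCF} (hpop : PopulationConsistent f) (hcomp : CompositionConsistent f)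
    {C S : Finset ℕ} {x y : ℕ} {u v : List ℕ}
    (hSC : S ⊆ C) (hx : x ∈ S) (hy : y ∉ C) (h : GoodAt f C S x u v) :
    Good f (insert y C) S (u ++ x :: y :: v) := by
  obtain ⟨t0, h0, h1, ht⟩ := exists_t0 hcomp
  obtain ⟨ι, _, w, us, vs, hV, hK, hr, i0, e1, e2, hw⟩ := h
  obtain ⟨a, b, c⟩ := KC hpop hcomp h0 h1 ht C S hSC x y hx hy w us vs hV hK hr (fun _ => 1)
    (fun _ => h1.le) (fun _ => le_rfl)
  exact ⟨_, _, _, _, a, b, c, (i0, true), by simp [pl, e1, e2], by simpa [pw] using hw⟩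

lemma GoodAt.right {f : PSCF} (hpop : PopulationConsistent f) (hcomp : CompositionConsistent f)
    {C S : Finset ℕ} {x y : ℕ} {u v : List ℕ}
    (hSC : S ⊆ C) (hx : x ∈ S) (hy : y ∉ C) (h : GoodAt f C S x u v) :
    Good f (insert y C) S (u ++ y :: x :: v) := by
  obtain ⟨t0, h0, h1, ht⟩ := exists_t0 hcomp
  obtain ⟨ι, _, w, us, vs, hV, hK, hr, i0, e1, e2, hw⟩ := h
  obtain ⟨a, b, c⟩ := KC hpop hcomp h0 h1 ht C S hSC x y hx hy w us vs hV hK hr (fun _ => t0)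
    (fun _ => le_rfl) (fun _ => h1.le)
  refine ⟨_, _, _, _, a, b, c, (i0, false), by simp [pl, e1, e2], ?_⟩
  simp only [pw, Bool.false_eq_true, if_false]
  exact mul_pos hw (by linarith)

lemma GoodAt.swap {f : PSCF} (hpop : PopulationConsistent f) (hcomp : CompositionConsistent f)
    {C S : Finset ℕ} {x y : ℕ} {u v : List ℕ}
    (hSC : S ⊆ C) (hx : x ∈ S) (hy : y ∉ C) (h : GoodAt f C S x u v) :
    dl (u ++ x :: y :: v) - dl (u ++ y :: x :: v) ∈ Submodule.span ℚ (Kp f (insert y C) S) := by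
  classical
  obtain ⟨t0, h0, h1, ht⟩ := exists_t0 hcomp
  obtain ⟨ι, _, w, us, vs, hV, hK, hr, i0, e1, e2, hw⟩ := h
  obtain ⟨-, b, -⟩ := KC hpop hcomp h0 h1 ht C S hSC x y hx hy w us vs hV hK hr (fun _ => t0)
    (fun _ => le_rfl) (fun _ => h1.le)
  obtain ⟨-, b', -⟩ := KC hpop hcomp h0 h1 ht C S hSC x y hx hy w us vs hV hK hr
    (fun i => if i = i0 then 1 else t0)
    (fun i => by split_ifs; exacts [h1.le, le_rfl])
    (fun i => by split_ifs; exacts [le_rfl, h1.le])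
  have hne : w i0 * (1 - t0) ≠ 0 := (mul_pos hw (by linarith)).ne'
  rw [← Submodule.smul_mem_iff _ hne]
  have := Submodule.sub_mem _ (Submodule.subset_span (R := ℚ) b') (Submodule.subset_span b)
  convert this using 1
  simp only [prof]
  rw [← Finset.sum_sub_distrib, Fintype.sum_prod_type, Finset.sum_eq_single i0]
  · simp only [Fintype.sum_bool, pw, pl, if_true, Bool.false_eq_true, if_false, e1, e2,
      List.append_assoc, List.cons_append, List.nil_append]
    module
  · intro i _ hi
    simp [hi]
  · simp

lemma good_all {f : PSCF} (hpop : PopulationConsistent f) (hcomp : CompositionConsistent f)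
    (S : Finset ℕ) (hS : S.Nonempty) : ∀ (n : ℕ) (A : Finset ℕ), S ⊆ A → (A \ S).card = n →
      ∀ l, Enum A l → Good f A S l := by
  intro n
  induction n with
  | zero =>
    intro A hSA hn l hl
    have : A = S := by
      apply Finset.Subset.antisymm _ hSA
      rwa [Finset.card_eq_zero, Finset.sdiff_eq_empty_iff_subset] at hn
    subst this
    have hr : ∀ a ∈ A, ∑ i, pw (1 / 2) i * bo A (sy l i) a = 0 := by
      intro x hx; simp [pw, sy, bo_reverse]; ring
    refine ⟨Bool, inferInstance, pw (1 / 2), sy l, sy_val hl, ⟨(sy_val hl).isProfile,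
      regular_prof (sy_val hl) hr,
      sym_pos hcomp l A (hl.ne_nil hS) hl _ (uni_lottery A hS) (uni_pos A)⟩, hr, true, by simp [sy],
      by simp [pw]⟩
  | succ n ih =>
    intro A hSA hn l hl
    have key : ∀ u x y v, x ∈ S → y ∉ S → Enum A (u ++ x :: y :: v) →
        y ∈ A ∧ GoodAt f (A.erase y) S x u v := by
      intro u x y v hx hy h
      have n1 := h.1
      have m1 := h.2
      simp only [List.nodup_append, List.nodup_cons, List.mem_cons] at n1
      simp only [List.mem_append, List.mem_cons] at m1
      have hyA : y ∈ A := by grind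
      refine ⟨hyA, Good.at (by have := hSA hx; grind) (ih _ (by
        intro z hz; have := hSA hz; rw [Finset.mem_erase]; exact ⟨by rintro rfl; exact hy hz, this⟩)
        ?_ _ ?_)⟩
      · rw [Finset.erase_sdiff_comm, Finset.card_erase_of_mem (by simp [hyA, hy]), hn]; rfl
      · refine ⟨?_, fun z => ?_⟩
        · simp only [List.nodup_append, List.nodup_cons, List.mem_cons]; grind
        · simp only [List.mem_append, List.mem_cons, Finset.mem_erase]; grind
    obtain ⟨u, a, b, v, e, h⟩ := adj_split (· ∈ S) l
      (by obtain ⟨x, hx⟩ := hS; exact ⟨x, (hl.2 x).2 (hSA hx), hx⟩)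
      (by
        obtain ⟨y, hy⟩ := Finset.card_pos.1 (by rw [hn]; omega : 0 < (A \ S).card)
        rw [Finset.mem_sdiff] at hy
        exact ⟨y, (hl.2 y).2 hy.1, hy.2⟩)
    subst e
    rcases h with ⟨ha, hb⟩ | ⟨ha, hb⟩
    · obtain ⟨hA, g⟩ := key u a b v ha hb hl
      have := g.left hpop hcomp (by
        intro z hz; rw [Finset.mem_erase]; exact ⟨by rintro rfl; exact hb hz, hSA hz⟩) ha
        (Finset.notMem_erase b A)
      rwa [Finset.insert_erase hA] at this
    · obtain ⟨hA, g⟩ := key u b a v hb ha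
        (hl.perm (List.Perm.append_left _ (List.Perm.swap _ _ _)))
      have := g.right hpop hcomp (by
        intro z hz; rw [Finset.mem_erase]; exact ⟨by rintro rfl; exact ha hz, hSA hz⟩) hb
        (Finset.notMem_erase a A)
      rwa [Finset.insert_erase hA] at this

lemma swap_mem {f : PSCF} (hpop : PopulationConsistent f) (hcomp : CompositionConsistent f)
    {A S : Finset ℕ} (hSA : S ⊆ A) {x y : ℕ} {u v : List ℕ}
    (hx : x ∈ S) (hy : y ∉ S) (h : Enum A (u ++ x :: y :: v)) :
    dl (u ++ x :: y :: v) - dl (u ++ y :: x :: v) ∈ Submodule.span ℚ (Kp f A S) := by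
  have n1 := h.1
  have m1 := h.2
  simp only [List.nodup_append, List.nodup_cons, List.mem_cons] at n1
  simp only [List.mem_append, List.mem_cons] at m1
  have hyA : y ∈ A := by grind
  have hsub : S ⊆ A.erase y := by
    intro z hz; rw [Finset.mem_erase]; exact ⟨by rintro rfl; exact hy hz, hSA hz⟩
  have g := good_all hpop hcomp S ⟨x, hx⟩ _ (A.erase y) hsub rfl (u ++ x :: v) (by
    refine ⟨?_, fun z => ?_⟩
    · simp only [List.nodup_append, List.nodup_cons, List.mem_cons]; grind
    · simp only [List.mem_append, List.mem_cons, Finset.mem_erase]; grind)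
  have := (Good.at (hsub hx) g).swap hpop hcomp hsub hx (Finset.notMem_erase y A)
  rwa [Finset.insert_erase hyA] at this

lemma move_mem {A S : Finset ℕ} {W : Submodule ℚ V}
    (hW : ∀ u x y v, x ∈ S → y ∉ S → Enum A (u ++ x :: y :: v) →
      dl (u ++ x :: y :: v) - dl (u ++ y :: x :: v) ∈ W) (a : ℕ) (ha : a ∉ S) (v : List ℕ) :
    ∀ (b u : List ℕ), (∀ x ∈ b, x ∈ S) → Enum A (u ++ a :: (b ++ v)) →
      dl (u ++ a :: (b ++ v)) - dl (u ++ (b ++ a :: v)) ∈ W := by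
  intro b
  induction b with
  | nil => intro u _ _; simp
  | cons x b ih =>
    intro u hb hE
    have h1 := ih (u ++ [x]) (fun z hz => hb z (by simp [hz]))
      (hE.perm (by
        simp only [List.append_assoc, List.cons_append, List.nil_append]
        exact List.Perm.append_left _ (List.Perm.swap _ _ _)))
    have h2 := hW u x a (b ++ v) (hb x (by simp)) ha
      (hE.perm (List.Perm.append_left _ (List.Perm.swap _ _ _)))
    simp only [List.append_assoc, List.cons_append, List.nil_append] at h1 ⊢
    have := W.sub_mem h1 h2
    convert this using 1
    abel

lemma bubble {A S : Finset ℕ} {W : Submodule ℚ V}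
    (hW : ∀ u x y v, x ∈ S → y ∉ S → Enum A (u ++ x :: y :: v) →
      dl (u ++ x :: y :: v) - dl (u ++ y :: x :: v) ∈ W) :
    ∀ l u : List ℕ, Enum A (u ++ l) →
      dl (u ++ l) - dl (u ++ (l.filter (· ∈ S) ++ l.filter (· ∉ S))) ∈ W := by
  intro l
  induction l with
  | nil => intro u _; simp
  | cons a l ih =>
    intro u hE
    have h1 := ih (u ++ [a]) (by simpa using hE)
    simp only [List.append_assoc, List.cons_append, List.nil_append] at h1
    by_cases ha : a ∈ S
    · simpa [List.filter_cons, ha] using h1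
    · have h2 := move_mem hW a ha (l.filter (· ∉ S)) (l.filter (· ∈ S)) u (by simp)
        (hE.perm (by
          refine List.Perm.append_left _ (List.Perm.cons _ ?_)
          have := (List.filter_append_perm (fun z => decide (z ∈ S)) l).symm
          simpa using this))
      have := W.add_mem h1 h2
      simp only [List.filter_cons, ha, decide_false, Bool.false_eq_true, if_false, not_false_eq_true,
        decide_true, if_true]
      convert this using 1
      abel

lemma abstract_zero {Q : Type*} [AddCommGroup Q] [Module ℚ Q] (e : List ℕ → Q) (S : Finset ℕ)
    (a0 : ℕ) (ha0 : a0 ∈ S)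
    (he1 : ∀ s, Enum S s → e s + e s.reverse = 0)
    (he2 : ∀ u v u' v' x y, Enum S (u ++ x :: y :: v) → Enum S (u' ++ x :: y :: v') →
      e (u ++ x :: y :: v) + e (v.reverse ++ x :: y :: u.reverse) + e (u' ++ y :: x :: v') +
        e (v'.reverse ++ y :: x :: u'.reverse) = 0)
    (he3 : ∀ v x y z, Enum S (x :: y :: z :: v) →
      e (x :: y :: z :: v) + e (y :: z :: x :: v) + e (z :: x :: y :: v) +
      e (v.reverse ++ [x, y, z]) + e (v.reverse ++ [y, z, x]) + e (v.reverse ++ [z, x, y]) = 0)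
    (hn : ∀ x ∈ S, x ≠ a0 → ∃ r, Enum S (x :: a0 :: r) ∧ e (x :: a0 :: r) = e (a0 :: x :: r)) :
    ∀ s, Enum S s → e s = 0 := by
  have hrev : ∀ s, Enum S s → e s.reverse = - e s := fun s hs =>
    eq_neg_of_add_eq_zero_right (he1 s hs)
  have sw : ∀ {u v : List ℕ} {x y : ℕ}, Enum S (u ++ x :: y :: v) → Enum S (u ++ y :: x :: v) :=
    fun h => h.perm (List.Perm.append_left _ (List.Perm.swap _ _ _))
  have hD : ∀ u v u' v' x y, Enum S (u ++ x :: y :: v) → Enum S (u' ++ x :: y :: v') →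
      e (u ++ x :: y :: v) - e (u ++ y :: x :: v) =
        e (u' ++ x :: y :: v') - e (u' ++ y :: x :: v') := by
    intro u v u' v' x y h h'
    have h1 := he2 u v u' v' x y h h'
    have h2 := hrev _ (sw h)
    have h3 := hrev _ h'
    simp only [List.reverse_append, List.reverse_cons, List.append_assoc, List.cons_append,
      List.nil_append] at h2 h3
    rw [h2, h3] at h1
    rw [← sub_eq_zero, ← h1]
    abel
  have hA : ∀ u v x, Enum S (u ++ x :: a0 :: v) → e (u ++ x :: a0 :: v) = e (u ++ a0 :: x :: v) := by
    intro u v x h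
    have n1 := h.1
    simp only [List.nodup_append, List.nodup_cons, List.mem_cons] at n1
    obtain ⟨r, hr, he⟩ := hn x ((h.2 x).1 (by simp)) (by grind)
    have := hD u v [] r x a0 h hr
    simp only [List.nil_append] at this
    rwa [he, sub_self, sub_eq_zero] at this
  have hall : ∀ u v x y, Enum S (u ++ x :: y :: v) →
      e (u ++ x :: y :: v) = e (u ++ y :: x :: v) := by
    intro u v x y h
    by_cases hy : y = a0
    · subst hy; exact hA u v x h
    by_cases hx : x = a0
    · subst hx; exact (hA u v y (sw h)).symm
    have n1 := h.1
    have m1 := h.2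
    simp only [List.nodup_append, List.nodup_cons, List.mem_cons] at n1
    simp only [List.mem_append, List.mem_cons] at m1
    have hxy : x ≠ y := by grind
    set r := (((S.erase a0).erase x).erase y).toList with hr
    have hE : Enum S ([] ++ x :: y :: a0 :: r) := by
      refine ⟨?_, fun z => ?_⟩
      · simp only [List.nil_append, List.nodup_cons, List.mem_cons, hr, Finset.mem_toList,
          Finset.mem_erase, Finset.nodup_toList]
        grind
      · simp only [List.nil_append, List.mem_cons, hr, Finset.mem_toList,
          Finset.mem_erase]
        grind
    have hE2 := sw hE
    have hE3 : Enum S ([x] ++ a0 :: y :: r) := sw (u := [x]) hE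
    have hE4 : Enum S ([y] ++ a0 :: x :: r) := sw (u := [y]) hE2
    have hE5 : Enum S ([] ++ a0 :: y :: x :: r) := sw (u := []) hE4
    have k := he3 r x y a0 hE
    have r1 := hrev _ hE5
    have r2 := hrev _ hE3
    have r3 := hrev _ hE2
    have s1 := hA [] (x :: r) y (sw (u := []) hE5)
    have s2 := hA [] (y :: r) x hE3
    have s3 := hA [x] r y hE
    have s4 := hA [y] r x hE2
    have d := hD u v [] (a0 :: r) x y h hE
    simp only [List.reverse_append, List.reverse_cons, List.append_assoc, List.cons_append,
      List.nil_append, List.reverse_nil, List.append_nil] at r1 r2 r3 s1 s2 s3 s4 d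
    rw [r1, r2, r3] at k
    rw [s4, s1, s3, s2] at k
    rw [s3, s2, s4, s1] at d
    rw [← sub_eq_zero, d, ← k]
    abel
  have hperm : ∀ l m : List ℕ, l.Perm m → ∀ u, Enum S (u ++ l) → e (u ++ l) = e (u ++ m) := by
    intro l m p
    induction p with
    | nil => intro u _; rfl
    | cons x _ ih =>
      intro u h
      simpa using ih (u ++ [x]) (by simpa using h)
    | swap x y l => intro u h; exact hall u l y x h
    | trans p1 p2 ih1 ih2 =>
      intro u h
      rw [ih1 u h]
      exact ih2 u (h.perm (p1.append_left _))
  intro s hs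
  have h1 := hperm s s.reverse (List.reverse_perm s).symm [] hs
  simp only [List.nil_append] at h1
  have h2 := he1 s hs
  rw [← h1, ← two_smul ℚ, smul_eq_zero] at h2
  simpa using h2

open Classical in
lemma all_mem {f : PSCF} (hpop : PopulationConsistent f) (hcomp : CompositionConsistent f)
    (A S : Finset ℕ) (hSA : S ⊆ A) (a0 : ℕ) (ha0 : a0 ∈ S) :
    ∃ g : ℕ → V, ∀ l, Enum A l →
      dl l ∈ Submodule.span ℚ (Kp f A S) ⊔
        Submodule.span ℚ (((S.erase a0).image g : Finset V) : Set V) := by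
  set D := A \ S with hDdef
  have hd : Disjoint S D := Finset.disjoint_sdiff
  have hSD : S ∪ D = A := Finset.union_sdiff_of_subset hSA
  have hS : S.Nonempty := ⟨a0, ha0⟩
  set t0 := D.toList with ht0
  have hEt : Enum D t0 := ⟨Finset.nodup_toList _, fun x => Finset.mem_toList⟩
  set rs : ℕ → List ℕ := fun x => ((S.erase x).erase a0).toList with hrs
  set g : ℕ → V := fun x => dl (x :: a0 :: rs x ++ t0) - dl (a0 :: x :: rs x ++ t0) with hg
  refine ⟨g, ?_⟩
  set W := Submodule.span ℚ (Kp f A S) with hWdef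
  set U := W ⊔ Submodule.span ℚ (((S.erase a0).image g : Finset V) : Set V) with hU
  have hKU : ∀ {R}, R ∈ Kp f (S ∪ D) S → R ∈ U := fun h =>
    (le_sup_left : W ≤ U) (Submodule.subset_span (by rwa [hSD] at h))
  have hz := abstract_zero (fun s => U.mkQ (dl (s ++ t0))) S a0 ha0 ?_ ?_ ?_ ?_
  · intro l hl
    have b := (le_sup_left : W ≤ U) (bubble (W := W)
      (fun u x y v hx hy h => swap_mem hpop hcomp hSA hx hy h) l [] hl)
    simp only [List.nil_append] at b
    set s := l.filter (· ∈ S) with hs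
    set t := l.filter (· ∉ S) with ht
    have hEs : Enum S s := by
      refine ⟨hl.1.filter _, fun x => ?_⟩
      simp only [hs, List.mem_filter, hl.2, decide_eq_true_eq]
      exact ⟨fun h => h.2, fun h => ⟨hSA h, h⟩⟩
    have hEt' : Enum D t := by
      refine ⟨hl.1.filter _, fun x => ?_⟩
      simp only [ht, List.mem_filter, hl.2, decide_eq_true_eq, hDdef, Finset.mem_sdiff]
    have c1 := hKU (K1 (f := f) hcomp S D hS hd s t t0 hEs hEt' hEt)
    have c2 := hKU (K1 (f := f) hcomp S D hS hd s t0 t0 hEs hEt hEt)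
    have z := hz s hEs
    simp only [Submodule.mkQ_apply, Submodule.Quotient.mk_eq_zero] at z
    have := U.add_mem (U.add_mem b (U.smul_mem 2 (U.sub_mem c1 c2))) z
    convert this using 1
    module
  · intro s hs
    have c := U.smul_mem 2 (hKU (K1 (f := f) hcomp S D hS hd s t0 t0 hs hEt hEt))
    simp only [← map_add]
    rw [Submodule.mkQ_apply, Submodule.Quotient.mk_eq_zero]
    convert c using 1
    module
  · intro u v u' v' x y h1 h2
    have c := U.smul_mem 4 (hKU (K2 (f := f) hpop hcomp S D hS hd u v u' v' x y t0 h1 h2 hEt))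
    simp only [← map_add]
    rw [Submodule.mkQ_apply, Submodule.Quotient.mk_eq_zero]
    convert c using 1
    module
  · intro v x y z h1
    have c := U.smul_mem 6 (hKU (K3 (f := f) hcomp S D hS hd v x y z t0 h1 hEt))
    simp only [← map_add]
    rw [Submodule.mkQ_apply, Submodule.Quotient.mk_eq_zero]
    convert c using 1
    module
  · intro x hx hxa
    refine ⟨rs x, ⟨?_, fun z => ?_⟩, ?_⟩
    · simp only [List.nodup_cons, List.mem_cons, hrs, Finset.mem_toList,
          Finset.mem_erase, Finset.nodup_toList]
      grind
    · simp only [List.mem_cons, hrs, Finset.mem_toList, Finset.mem_erase]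
      grind
    · rw [← sub_eq_zero, ← map_sub, Submodule.mkQ_apply, Submodule.Quotient.mk_eq_zero]
      refine (le_sup_right : _ ≤ U) (Submodule.subset_span ?_)
      simp only [Finset.coe_image, Set.mem_image, Finset.mem_coe, Finset.mem_erase]
      exact ⟨x, ⟨hxa, hx⟩, rfl⟩

lemma dl_single (l : List ℕ) : dl l = Pi.single (ord l) 1 := by
  funext r
  simp only [dl, Pi.single_apply]

lemma W_fin (f : PSCF) (A S : Finset ℕ) :
    FiniteDimensional ℚ (Submodule.span ℚ (Kp f A S)) := by
  classical
  set F : Finset V := (linOrders A).image (fun r => Pi.single r (1 : ℚ)) with hF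
  have hle : Submodule.span ℚ (Kp f A S) ≤ Submodule.span ℚ (F : Set V) := by
    rw [Submodule.span_le]
    intro R hR
    have : R = ∑ r ∈ linOrders A, R r • (Pi.single r (1 : ℚ) : V) := by
      funext q
      simp only [Finset.sum_apply, Pi.smul_apply, Pi.single_apply, smul_eq_mul, mul_ite, mul_one,
        mul_zero, Finset.sum_ite_eq]
      split_ifs with h
      · rfl
      · exact hR.1.1 q h
    rw [this]
    refine Submodule.sum_mem _ fun r hr => Submodule.smul_mem _ _ (Submodule.subset_span ?_)
    simp only [hF, Finset.coe_image, Set.mem_image, Finset.mem_coe]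
    exact ⟨r, hr, rfl⟩
  have : FiniteDimensional ℚ (Submodule.span ℚ (F : Set V)) :=
    FiniteDimensional.span_finset ℚ F
  exact Submodule.finiteDimensional_of_le hle

lemma dim_W {f : PSCF} (hpop : PopulationConsistent f) (hcomp : CompositionConsistent f)
    (A S : Finset ℕ) (hSA : S ⊆ A) (hS : S.Nonempty) :
    A.card.factorial + 1 ≤ Module.finrank ℚ (Submodule.span ℚ (Kp f A S)) + S.card := by
  classical
  obtain ⟨a0, ha0⟩ := hS
  obtain ⟨g, hg⟩ := all_mem hpop hcomp A S hSA a0 ha0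
  have := W_fin f A S
  have hGf : FiniteDimensional ℚ
      (Submodule.span ℚ (((S.erase a0).image g : Finset V) : Set V)) :=
    FiniteDimensional.span_finset ℚ _
  set W := Submodule.span ℚ (Kp f A S)
  set G := Submodule.span ℚ (((S.erase a0).image g : Finset V) : Set V) with hGdef
  have h1 : Module.finrank ℚ G ≤ S.card - 1 := by
    rw [← Finset.card_erase_of_mem ha0]
    exact (finrank_span_finset_le_card (R := ℚ) _).trans Finset.card_image_le
  have h2 := Submodule.finrank_add_le_finrank_add_finrank W G
  set T := A.toList.permutations.toFinset with hT
  have hTE : ∀ l ∈ T, Enum A l := by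
    intro l hl
    rw [hT, List.mem_toFinset, List.mem_permutations] at hl
    exact Enum.perm ⟨Finset.nodup_toList _, fun x => Finset.mem_toList⟩ hl.symm
  have hTc : Fintype.card T = A.card.factorial := by
    rw [Fintype.card_coe, hT, List.toFinset_card_of_nodup
      (List.nodup_permutations _ (Finset.nodup_toList _)), List.length_permutations,
      Finset.length_toList]
  have hli : LinearIndependent ℚ (fun l : T => dl l.1) := by
    have := (Pi.linearIndependent_single_one (Finset (ℕ × ℕ)) ℚ).comp (fun l : T => ord l.1) (by
      intro l m h
      exact Subtype.ext (ord_inj (hTE _ l.2).1 (hTE _ m.2).1 h))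
    convert this using 1
    funext l
    exact dl_single l.1
  have hli' : LinearIndependent ℚ (fun l : T => (⟨dl l.1, hg _ (hTE _ l.2)⟩ : ↥(W ⊔ G))) :=
    LinearIndependent.of_comp (W ⊔ G).subtype hli
  have h3 := hli'.fintype_card_le_finrank
  rw [hTc] at h3
  have : 0 < S.card := Finset.card_pos.2 ⟨a0, ha0⟩
  omega

/-- For every population-consistent and composition-consistent PSCF and `A' ⊆ A`, there is
a set of profiles regular on `A'` of affine dimension `|A|! - |A'|` on which `f` returns
the uniform lottery over `A'`. -/
theorem regular_uniform_set (f : PSCF) (hpop : PopulationConsistent f)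
    (hcomp : CompositionConsistent f) (A A' : Finset ℕ) (hA' : A'.Nonempty)
    (hsub : A' ⊆ A) :
    ∃ X : Set (Finset (ℕ × ℕ) → ℚ),
      (∀ R ∈ X, IsProfile A R ∧ Regular A A' R ∧ uniLottery A' ∈ f.choice A R) ∧
      Module.finrank ℚ ↥(vectorSpan ℚ X) = Nat.factorial A.card - A'.card := by
  have hdim := dim_W hpop hcomp A A' hsub hA'
  have hfin := W_fin f A A'
  obtain ⟨b, hb, hspan, hli⟩ := exists_linearIndependent ℚ (Kp f A A')
  have hle : A'.card ≤ A.card.factorial :=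
    (Finset.card_le_card hsub).trans (Nat.self_le_factorial _)
  rw [← hspan] at hfin hdim
  have hbf : b.Finite := by
    have hli' : LinearIndependent ℚ
        (fun x : b => (⟨x.1, Submodule.subset_span x.2⟩ : ↥(Submodule.span ℚ b))) :=
      LinearIndependent.of_comp (Submodule.span ℚ b).subtype hli
    have := hli'.finite
    exact Set.toFinite b
  obtain ⟨c, rfl⟩ := hbf.exists_finset_coe
  rw [finrank_span_finset_eq_card hli] at hdim
  obtain ⟨d, hdc, hd⟩ := Finset.exists_subset_card_eq
    (show A.card.factorial - A'.card + 1 ≤ c.card by omega)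
  refine ⟨(d : Set V), fun R hR => hb (hdc hR), ?_⟩
  have hld : LinearIndependent ℚ (fun x : (d : Set V) => (x : V)) :=
    hli.comp (fun x : (d : Set V) => (⟨x.1, hdc x.2⟩ : ((c : Finset V) : Set V)))
      (fun x y h => Subtype.ext (congrArg (fun z => z.1) h))
  have := hld.affineIndependent.finrank_vectorSpan (n := A.card.factorial - A'.card)
    (by simpa using hd)
  rwa [Subtype.range_coe] at this

end PSC
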